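/- Let N = 1 and let A ∈ ℝ^{n×n} be a symmetric positive definite matrix with smallest eigenvalue ν(A) = min_{|a|=1} A:a⊗a. Let Ω ⊆ ℝⁿ be an open, bounded, convex set with C² boundary. Then for every function v ∈ (H² ∩ H¹₀)(Ω) one has ν(A)² ∫_Ω |D²v|² dx ≤ ∫_Ω |A : D²v|² dx, i.e. ‖D²v‖_{L²(Ω)} ≤ (1/ν(A)) ‖A:D²v‖_{L²(Ω)}. -/

import Mathlib

open MeasureTheory Filter Topology
open scoped BigOperators

noncomputable section

/-- `Euc n` is the Euclidean space `ℝⁿ`. -/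
abbrev Euc (n : ℕ) : Type := EuclideanSpace ℝ (Fin n)

/-- Squared Euclidean norm of a finite vector. -/
def vsq {m : ℕ} (v : Fin m → ℝ) : ℝ := ∑ i, (v i) ^ 2

/-- Squared Euclidean norm of a third order tensor `X ∈ ℝ^{N×n×n}`. -/
def tsq {N n : ℕ} (X : Fin N → Fin n → Fin n → ℝ) : ℝ :=
  ∑ α, ∑ i, ∑ j, (X α i j) ^ 2

/-- First partial derivative `D_i f`. -/
def pder {n : ℕ} (f : Euc n → ℝ) (i : Fin n) (x : Euc n) : ℝ :=
  fderiv ℝ f x (EuclideanSpace.single i 1)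

/-- Second partial derivative `D²_{ij} f`. -/
def pder2 {n : ℕ} (f : Euc n → ℝ) (i j : Fin n) (x : Euc n) : ℝ :=
  pder (fun y => pder f j y) i x

/-- Hessian tensor `D²u(x) ∈ ℝ^{Nn²}` of a vector valued map `u : ℝⁿ → ℝ^N`. -/
def Hess {n N : ℕ} (u : Euc n → Fin N → ℝ) (x : Euc n) : Fin N → Fin n → Fin n → ℝ :=
  fun α i j => pder2 (fun y => u y α) i j x

/-- The contraction `(𝐀:X)_α = Σ_{i,β,j} A_{αiβj} X_{βij}`. -/
def AC {n N : ℕ} (A : Fin N → Fin n → Fin N → Fin n → ℝ)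
    (X : Fin N → Fin n → Fin n → ℝ) : Fin N → ℝ :=
  fun α => ∑ i, ∑ β, ∑ j, A α i β j * X β i j

/-- The quadratic form `𝐀 : η⊗a⊗η⊗a = Σ A_{αiβj} η_α a_i η_β a_j`. -/
def QF {n N : ℕ} (A : Fin N → Fin n → Fin N → Fin n → ℝ)
    (η : Fin N → ℝ) (a : Fin n → ℝ) : ℝ :=
  ∑ α, ∑ i, ∑ β, ∑ j, A α i β j * η α * a i * η β * a j

/-- Symmetry `A_{αiβj} = A_{βjαi}` of a fourth order tensor (i.e. `𝐀 ∈ ℝ^{Nn×Nn}_s`). -/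
def SymT {n N : ℕ} (A : Fin N → Fin n → Fin N → Fin n → ℝ) : Prop :=
  ∀ α i β j, A α i β j = A β j α i

/-- Symmetry `X_{αij} = X_{αji}`, i.e. `X ∈ ℝ^{Nn²}_s`. -/
def SymX {n N : ℕ} (X : Fin N → Fin n → Fin n → ℝ) : Prop :=
  ∀ α i j, X α i j = X α j i

/-- `𝐀` is rank-one positive: `𝐀:η⊗a⊗η⊗a ≥ ν |η|²|a|²` for some `ν > 0`. -/
def RankOnePos {n N : ℕ} (A : Fin N → Fin n → Fin N → Fin n → ℝ) : Prop :=
  ∃ ν > (0:ℝ), ∀ (η : Fin N → ℝ) (a : Fin n → ℝ), ν * vsq η * vsq a ≤ QF A η a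

/-- The ellipticity constant `ν(𝐀) = min_{|η|=|a|=1} 𝐀:η⊗a⊗η⊗a`. -/
def nuA {n N : ℕ} (A : Fin N → Fin n → Fin N → Fin n → ℝ) : ℝ :=
  sInf {v | ∃ (η : Fin N → ℝ) (a : Fin n → ℝ), vsq η = 1 ∧ vsq a = 1 ∧ v = QF A η a}

/-- The smallest eigenvalue `λ₁(M) = min_{|a|=1} M:a⊗a` of a symmetric matrix. -/
def lam1 {m : ℕ} (M : Matrix (Fin m) (Fin m) ℝ) : ℝ :=
  sInf {v | ∃ a : Fin m → ℝ, vsq a = 1 ∧ v = ∑ i, ∑ j, M i j * a i * a j}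

/-- The structural hypothesis (SH) for `𝐀` with the decomposition data
`𝐀 = Σ_γ B^γ ⊗ A^γ` given explicitly. -/
def SHdata {n N : ℕ} (A : Fin N → Fin n → Fin N → Fin n → ℝ)
    (B : Fin N → Matrix (Fin N) (Fin N) ℝ)
    (M : Fin N → Matrix (Fin n) (Fin n) ℝ) : Prop :=
  (∀ γ, (B γ).IsSymm) ∧ (∀ γ, (M γ).IsSymm) ∧
  (∀ α i β j, A α i β j = ∑ γ, B γ α β * M γ i j) ∧
  (∀ γ δ, γ ≠ δ → ∀ y z : Fin N → ℝ, ∑ α, (B γ).mulVec y α * (B δ).mulVec z α = 0) ∧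
  (∑ γ, B γ).PosDef ∧ (∀ γ, (M γ).PosDef) ∧
  (∃ a : Fin n → ℝ, a ≠ 0 ∧ ∀ γ, (M γ).mulVec a = lam1 (M γ) • a)

/-- The structural hypothesis (SH). -/
def SH {n N : ℕ} (A : Fin N → Fin n → Fin N → Fin n → ℝ) : Prop :=
  ∃ B M, SHdata A B M

/-- `Ω` is a (bounded) domain with `C²` boundary, encoded via a `C²` defining function
with nonvanishing gradient on the boundary. -/
def IsC2Domain {n : ℕ} (Ω : Set (Euc n)) : Prop :=
  ∃ ρ : Euc n → ℝ, ContDiff ℝ 2 ρ ∧ Ω = {x | ρ x < 0} ∧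
    ∀ x ∈ frontier Ω, fderiv ℝ ρ x ≠ 0

/-- `F : Ω × ℝ^{Nn²}_s → ℝ^N` is a Carathéodory map: measurable in `x`, continuous in `X`. -/
def Caratheodory {n N : ℕ} (Ω : Set (Euc n))
    (F : Euc n → (Fin N → Fin n → Fin n → ℝ) → Fin N → ℝ) : Prop :=
  (∀ X, Measurable fun x => F x X) ∧
  (∀ᵐ x ∂(volume.restrict Ω), Continuous fun X => F x X)

/-- The K-condition (ellipticity) for `F` with data `(𝐀, α, β, γ)`. -/
def KCond {n N : ℕ} (Ω : Set (Euc n))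
    (F : Euc n → (Fin N → Fin n → Fin n → ℝ) → Fin N → ℝ)
    (A : Fin N → Fin n → Fin N → Fin n → ℝ)
    (al : Euc n → ℝ) (β γ : ℝ) : Prop :=
  SymT A ∧ RankOnePos A ∧ Measurable al ∧
  (∃ C : ℝ, ∀ᵐ x ∂(volume.restrict Ω), |al x| ≤ C) ∧
  (∀ᵐ x ∂(volume.restrict Ω), 0 < al x) ∧
  (∃ C : ℝ, ∀ᵐ x ∂(volume.restrict Ω), |1 / al x| ≤ C) ∧
  0 < β ∧ 0 < γ ∧ β + γ < 1 ∧
  (∀ᵐ x ∂(volume.restrict Ω), ∀ X Z : Fin N → Fin n → Fin n → ℝ, SymX X → SymX Z →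
    Real.sqrt (vsq fun α => AC A Z α - al x * (F x (X + Z) α - F x X α)) ≤
      β * nuA A * Real.sqrt (tsq Z) + γ * Real.sqrt (vsq (AC A Z)))

/-- Membership `u ∈ (H² ∩ H¹₀)(Ω)^N` (as a strong/classical object): twice
differentiable on `Ω`, with `u`, `Du`, `D²u` square integrable on `Ω`, and zero
boundary trace. -/
structure IsH2H10 {n N : ℕ} (Ω : Set (Euc n)) (u : Euc n → Fin N → ℝ) : Prop where
  contDiffOn : ∀ α, ContDiffOn ℝ 2 (fun x => u x α) Ω
  memL2 : IntegrableOn (fun x => vsq (u x)) Ω volume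
  grad_memL2 : IntegrableOn (fun x => ∑ α, ∑ i, (pder (fun y => u y α) i x) ^ 2) Ω volume
  hess_memL2 : IntegrableOn (fun x => tsq (Hess u x)) Ω volume
  zero_trace : ∀ x ∈ frontier Ω, Tendsto u (nhdsWithin x Ω) (nhds 0)

/-- The `L²(Ω)^N` norm of a vector valued map. -/
def L2V {n N : ℕ} (Ω : Set (Euc n)) (g : Euc n → Fin N → ℝ) : ℝ :=
  Real.sqrt (∫ x in Ω, vsq (g x))

/-- The `L²(Ω)` norm of a tensor valued map. -/
def L2T {n N : ℕ} (Ω : Set (Euc n)) (G : Euc n → Fin N → Fin n → Fin n → ℝ) : ℝ :=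
  Real.sqrt (∫ x in Ω, tsq (G x))

/-- The `H²(Ω)^N` norm `‖u‖_{L²} + ‖Du‖_{L²} + ‖D²u‖_{L²}`. -/
def H2norm {n N : ℕ} (Ω : Set (Euc n)) (u : Euc n → Fin N → ℝ) : ℝ :=
  L2V Ω u + Real.sqrt (∫ x in Ω, ∑ α, ∑ i, (pder (fun y => u y α) i x) ^ 2) +
    L2T Ω (fun x => Hess u x)

end

open MeasureTheory Filter

noncomputable section

/-- Membership `v ∈ (H² ∩ H¹₀)(Ω)` for a scalar function (strong/classical encoding):
twice differentiable on `Ω`, with `v`, `Dv`, `D²v` square integrable on `Ω`,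
and zero boundary trace. -/
structure IsH2H10s {n : ℕ} (Ω : Set (Euc n)) (v : Euc n → ℝ) : Prop where
  contDiffOn : ContDiffOn ℝ 2 v Ω
  memL2 : IntegrableOn (fun x => (v x) ^ 2) Ω volume
  grad_memL2 : IntegrableOn (fun x => ∑ i, (pder v i x) ^ 2) Ω volume
  hess_memL2 : IntegrableOn (fun x => ∑ i, ∑ j, (pder2 v i j x) ^ 2) Ω volume
  zero_trace : ∀ x ∈ frontier Ω, Tendsto v (nhdsWithin x Ω) (nhds 0)

end

open MeasureTheory Filter Topology

namespace MT

variable {n : ℕ}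

/-- basis vector -/
noncomputable abbrev ee (i : Fin n) : Euc n := EuclideanSpace.single i 1

lemma pder_mul {f g : Euc n → ℝ} {x : Euc n} (i : Fin n) (hf : DifferentiableAt ℝ f x)
    (hg : DifferentiableAt ℝ g x) :
    pder (fun y => f y * g y) i x = pder f i x * g x + f x * pder g i x := by
  simp only [pder]
  rw [fderiv_fun_mul hf hg]
  simp
  ring

lemma pder_sub {f g : Euc n → ℝ} {x : Euc n} (i : Fin n) (hf : DifferentiableAt ℝ f x)
    (hg : DifferentiableAt ℝ g x) :
    pder (fun y => f y - g y) i x = pder f i x - pder g i x := by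
  simp only [pder]
  rw [fderiv_fun_sub hf hg]
  simp

lemma pder_add {f g : Euc n → ℝ} {x : Euc n} (i : Fin n) (hf : DifferentiableAt ℝ f x)
    (hg : DifferentiableAt ℝ g x) :
    pder (fun y => f y + g y) i x = pder f i x + pder g i x := by
  simp only [pder]
  rw [fderiv_fun_add hf hg]
  simp

lemma pder_comp {f : Euc n → ℝ} {k : ℝ → ℝ} {x : Euc n} (i : Fin n)
    (hf : DifferentiableAt ℝ f x) (hk : DifferentiableAt ℝ k (f x)) :
    pder (fun y => k (f y)) i x = deriv k (f x) * pder f i x := by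
  simp only [pder]
  have := (hk.hasDerivAt.comp_hasFDerivAt x hf.hasFDerivAt).fderiv
  change fderiv ℝ (k ∘ f) x _ = _
  rw [this]
  simp

lemma contDiffOn_pder {f : Euc n → ℝ} {Ω : Set (Euc n)} (hΩ : IsOpen Ω) (i : Fin n)
    {m k : ℕ} (h : m + 1 ≤ k) (hf : ContDiffOn ℝ k f Ω) : ContDiffOn ℝ m (pder f i) Ω := by
  have h1 : ContDiffOn ℝ m (fun x => fderiv ℝ f x) Ω :=
    hf.fderiv_of_isOpen hΩ (by exact_mod_cast h)
  exact h1.clm_apply contDiffOn_const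

lemma contDiff_pder {f : Euc n → ℝ} (i : Fin n)
    {m k : ℕ} (h : m + 1 ≤ k) (hf : ContDiff ℝ k f) : ContDiff ℝ m (pder f i) := by
  rw [← contDiffOn_univ] at hf ⊢
  exact contDiffOn_pder isOpen_univ i h hf

lemma diffAt_of_contDiffOn {f : Euc n → ℝ} {Ω : Set (Euc n)} (hΩ : IsOpen Ω)
    (hf : ContDiffOn ℝ 1 f Ω) {x : Euc n} (hx : x ∈ Ω) : DifferentiableAt ℝ f x :=
  (hf.differentiableOn (by norm_num)).differentiableAt (hΩ.mem_nhds hx)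

lemma pder2_symm {f : Euc n → ℝ} {Ω : Set (Euc n)} (hΩ : IsOpen Ω)
    (hf : ContDiffOn ℝ 2 f Ω) {x : Euc n} (hx : x ∈ Ω) (i j : Fin n) :
    pder2 f i j x = pder2 f j i x := by
  have hc : ContDiffAt ℝ 2 f x := hf.contDiffAt (hΩ.mem_nhds hx)
  have hs : IsSymmSndFDerivAt ℝ f x := hc.isSymmSndFDerivAt (by simp)
  have hd : DifferentiableAt ℝ (fderiv ℝ f) x :=
    (hc.fderiv_right (m := 1) (by norm_num)).differentiableAt (by norm_num)
  have key : ∀ i j : Fin n, pder2 f i j x = fderiv ℝ (fderiv ℝ f) x (ee i) (ee j) := by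
    intro i j
    simp only [pder2, pder]
    rw [fderiv_clm_apply hd (by fun_prop)]
    simp
  rw [key, key]
  exact hs _ _

/-- extension by zero -/
lemma contDiff_of_support {F : Euc n → ℝ} {Ω K : Set (Euc n)} (hΩ : IsOpen Ω) {m : ℕ}
    (hF : ContDiffOn ℝ m F Ω) (hK : IsCompact K) (hKΩ : K ⊆ Ω) (h0 : ∀ x, x ∉ K → F x = 0) :
    ContDiff ℝ m F := by
  rw [contDiff_iff_contDiffAt]
  intro x
  by_cases hx : x ∈ K
  · exact hF.contDiffAt (hΩ.mem_nhds (hKΩ hx))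
  · have : F =ᶠ[𝓝 x] fun _ => 0 := by
      filter_upwards [hK.isClosed.isOpen_compl.mem_nhds hx] with y hy using h0 y hy
    exact contDiffAt_const.congr_of_eventuallyEq this

lemma pder_zero_off {F : Euc n → ℝ} {K : Set (Euc n)}
    (hK : IsCompact K) (h0 : ∀ x, x ∉ K → F x = 0) (i : Fin n) {x : Euc n} (hx : x ∉ K) :
    pder F i x = 0 := by
  have : F =ᶠ[𝓝 x] fun _ => 0 := by
    filter_upwards [hK.isClosed.isOpen_compl.mem_nhds hx] with y hy using h0 y hy
  simp only [pder]
  rw [this.fderiv_eq]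
  simp

lemma hcs {F : Euc n → ℝ} {K : Set (Euc n)}
    (hK : IsCompact K) (h0 : ∀ x, x ∉ K → F x = 0) : HasCompactSupport F :=
  HasCompactSupport.intro hK h0

lemma setInt_eq {F : Euc n → ℝ} {Ω K : Set (Euc n)} (hKΩ : K ⊆ Ω) (h0 : ∀ x, x ∉ K → F x = 0) :
    ∫ x in Ω, F x = ∫ x, F x := by
  apply setIntegral_eq_integral_of_forall_compl_eq_zero
  intro x hx
  exact h0 x (fun h => hx (hKΩ h))

lemma ibp_global {F : Euc n → ℝ} (hF : ContDiff ℝ 1 F) (hc : HasCompactSupport F) (i : Fin n) :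
    ∫ x, pder F i x = 0 := by
  have hcont : Continuous (fun x => fderiv ℝ F x (ee i)) :=
    (hF.continuous_fderiv (by norm_num)).clm_apply continuous_const
  have hc' : HasCompactSupport (fun x => fderiv ℝ F x (ee i)) := hc.fderiv_apply ℝ _
  have := integral_mul_fderiv_eq_neg_fderiv_mul_of_integrable (μ := (volume : Measure (Euc n)))
    (f := fun _ => (1:ℝ)) (g := F) (v := ee i) (by simp)
    (by simpa using hcont.integrable_of_hasCompactSupport hc')
    (by simpa using hF.continuous.integrable_of_hasCompactSupport hc)
    (by intros; fun_prop) (fun x _ => (hF.differentiable (by norm_num)) x)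
  simpa [pder] using this

lemma ibp {F : Euc n → ℝ} {Ω K : Set (Euc n)} (hΩ : IsOpen Ω)
    (hF : ContDiffOn ℝ 1 F Ω) (hK : IsCompact K) (hKΩ : K ⊆ Ω) (h0 : ∀ x, x ∉ K → F x = 0)
    (i : Fin n) : ∫ x in Ω, pder F i x = 0 := by
  rw [setInt_eq hKΩ (fun x hx => pder_zero_off hK h0 i hx)]
  exact ibp_global (contDiff_of_support hΩ (by exact_mod_cast hF) hK hKΩ h0) (hcs hK h0) i

lemma int_of_support {F : Euc n → ℝ} {Ω K : Set (Euc n)} (hΩ : IsOpen Ω)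
    (hF : ContinuousOn F Ω) (hK : IsCompact K) (hKΩ : K ⊆ Ω) (h0 : ∀ x, x ∉ K → F x = 0) :
    IntegrableOn F Ω := by
  have : Continuous F := by
    have := contDiff_of_support (m := 0) hΩ (by exact_mod_cast (contDiffOn_zero (𝕜 := ℝ)).2 hF) hK hKΩ h0
    exact this.continuous
  exact (this.integrable_of_hasCompactSupport (hcs hK h0)).integrableOn

/-- weak Schwarz -/
lemma weak_schwarz {F g : Euc n → ℝ} (hF : ContDiff ℝ 1 F) (hc : HasCompactSupport F)
    (hg : ContDiff ℝ 1 g) (hgc : HasCompactSupport g) (j l : Fin n) :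
    ∫ x, pder F j x * pder g l x = ∫ x, pder F l x * pder g j x := by
  have cF : ∀ j, Continuous (pder F j) := fun j =>
    (hF.continuous_fderiv (by norm_num)).clm_apply continuous_const
  have cg : ∀ j, Continuous (pder g j) := fun j =>
    (hg.continuous_fderiv (by norm_num)).clm_apply continuous_const
  have sF : ∀ j, HasCompactSupport (pder F j) := fun j => hc.fderiv_apply ℝ _
  have sg : ∀ j, HasCompactSupport (pder g j) := fun j => hgc.fderiv_apply ℝ _
  have dF : Differentiable ℝ F := hF.differentiable (by norm_num)
  have dg : Differentiable ℝ g := hg.differentiable (by norm_num)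
  have tr : ∀ t : ℝ, ∫ x, pder F j x * g (x + t • ee l) = - ∫ x, F (x + t • (-ee l)) * pder g j x := by
    intro t
    have h1 : ∫ x, pder (fun y => F y * g (y + t • ee l)) j x = 0 := by
      apply ibp_global
      · exact hF.mul (hg.comp (contDiff_id.add contDiff_const))
      · exact hc.mul_right
    have e : ∀ x, pder (fun y => F y * g (y + t • ee l)) j x
        = pder F j x * g (x + t • ee l) + F x * pder g j (x + t • ee l) := by
      intro x
      have hd : DifferentiableAt ℝ (fun y => g (y + t • ee l)) x := by fun_prop
      rw [pder_mul j (dF x) hd]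
      congr 2
      simp only [pder]
      rw [fderiv_comp_add_right]
    simp_rw [e] at h1
    rw [integral_add] at h1
    · have h2 : ∫ x, F x * pder g j (x + t • ee l) = ∫ x, F (x + t • (-ee l)) * pder g j x := by
        rw [← integral_add_right_eq_self (fun x => F (x + t • (-ee l)) * pder g j x) (t • ee l)]
        congr 1
        ext x
        simp
      linarith
    · exact ((cF j).mul (hg.continuous.comp (by fun_prop))).integrable_of_hasCompactSupport
        (sF j).mul_right
    · exact (hF.continuous.mul ((cg j).comp (by fun_prop))).integrable_of_hasCompactSupport
        hc.mul_right
  have deriv_gen : ∀ (a b : Euc n → ℝ) (w : Euc n), Continuous a → HasCompactSupport a →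
      ContDiff ℝ 1 b → HasCompactSupport b →
      HasDerivAt (fun t : ℝ => ∫ x, a x * b (x + t • w)) (∫ x, a x * fderiv ℝ b x w) 0 := by
    intro a b w ha hac hb hbc
    have cb : Continuous (fun x => fderiv ℝ b x w) :=
      (hb.continuous_fderiv (by norm_num)).clm_apply continuous_const
    obtain ⟨C, hC⟩ := (hbc.fderiv_apply ℝ w).exists_bound_of_continuous cb
    have := (hasDerivAt_integral_of_dominated_loc_of_deriv_le (μ := (volume : Measure (Euc n)))
      (F := fun (t : ℝ) x => a x * b (x + t • w))
      (F' := fun (t : ℝ) x => a x * fderiv ℝ b (x + t • w) w) (x₀ := (0:ℝ))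
      (bound := fun x => |a x| * C) (s := Set.univ) Filter.univ_mem
      (Eventually.of_forall fun t => (ha.mul (hb.continuous.comp (by fun_prop))).aestronglyMeasurable)
      ((ha.mul (hb.continuous.comp (by fun_prop))).integrable_of_hasCompactSupport hac.mul_right)
      ((ha.mul (cb.comp (by fun_prop))).aestronglyMeasurable)
      (Eventually.of_forall fun x t _ => by
        rw [norm_mul, Real.norm_eq_abs]
        gcongr
        exact hC _)
      (((ha.integrable_of_hasCompactSupport hac).abs).mul_const C)
      (Eventually.of_forall fun x t _ => by
        have h1 : HasDerivAt (fun t : ℝ => x + t • w) w t := by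
          simpa using ((hasDerivAt_id t).smul_const w).const_add x
        have h2 := ((hb.differentiable (by norm_num)) (x + t • w)).hasFDerivAt
        exact (h2.comp_hasDerivAt t h1).const_mul _)).2
    simpa using this
  have d1 := deriv_gen (pder F j) g (ee l) (cF j) (sF j) hg hgc
  have d2 := deriv_gen (pder g j) F (-ee l) (cg j) (sg j) hF hc
  have d3 : HasDerivAt (fun t : ℝ => ∫ x, pder F j x * g (x + t • ee l))
      (-∫ x, pder g j x * fderiv ℝ F x (-ee l)) 0 := by
    have := d2.neg
    refine this.congr_of_eventuallyEq (Eventually.of_forall fun t => ?_)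
    simp only [tr t, Pi.neg_apply]
    simp_rw [mul_comm]
  have := d1.unique d3
  rw [← integral_neg] at this
  simp only [map_neg, mul_neg, neg_neg] at this
  simp_rw [mul_comm (pder F l _)]
  exact this

end MT

open MeasureTheory Filter Topology

namespace MT

variable {n : ℕ}

/-- contraction with `A ⊗ A` -/
def CC (A : Matrix (Fin n) (Fin n) ℝ) (t : Fin n → Fin n → Fin n → Fin n → ℝ) : ℝ :=
  ∑ i, ∑ j, ∑ k, ∑ l, A i j * A k l * t i j k l

lemma CC_add (A : Matrix (Fin n) (Fin n) ℝ) (s t : Fin n → Fin n → Fin n → Fin n → ℝ) :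
    CC A (fun i j k l => s i j k l + t i j k l) = CC A s + CC A t := by
  simp only [CC, mul_add, Finset.sum_add_distrib]

lemma CC_smul (A : Matrix (Fin n) (Fin n) ℝ) (c : ℝ) (t : Fin n → Fin n → Fin n → Fin n → ℝ) :
    CC A (fun i j k l => c * t i j k l) = c * CC A t := by
  simp only [CC, Finset.mul_sum]
  refine Finset.sum_congr rfl fun i _ => Finset.sum_congr rfl fun j _ =>
    Finset.sum_congr rfl fun k _ => Finset.sum_congr rfl fun l _ => by ring

lemma CC_neg (A : Matrix (Fin n) (Fin n) ℝ) (t : Fin n → Fin n → Fin n → Fin n → ℝ) :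
    CC A (fun i j k l => - t i j k l) = - CC A t := by
  simpa using CC_smul A (-1) t

lemma CC_sub (A : Matrix (Fin n) (Fin n) ℝ) (s t : Fin n → Fin n → Fin n → Fin n → ℝ) :
    CC A (fun i j k l => s i j k l - t i j k l) = CC A s - CC A t := by
  simp only [sub_eq_add_neg]
  rw [CC_add, CC_neg]

lemma CC_swap12 {A : Matrix (Fin n) (Fin n) ℝ} (hA : ∀ i j, A i j = A j i)
    (t : Fin n → Fin n → Fin n → Fin n → ℝ) :
    CC A (fun i j k l => t j i k l) = CC A t := by
  simp only [CC]
  rw [Finset.sum_comm]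
  refine Finset.sum_congr rfl fun i _ => Finset.sum_congr rfl fun j _ =>
    Finset.sum_congr rfl fun k _ => Finset.sum_congr rfl fun l _ => by rw [hA i j]

lemma CC_swap34 {A : Matrix (Fin n) (Fin n) ℝ} (hA : ∀ i j, A i j = A j i)
    (t : Fin n → Fin n → Fin n → Fin n → ℝ) :
    CC A (fun i j k l => t i j l k) = CC A t := by
  simp only [CC]
  refine Finset.sum_congr rfl fun i _ => Finset.sum_congr rfl fun j _ => ?_
  rw [Finset.sum_comm]
  refine Finset.sum_congr rfl fun k _ => Finset.sum_congr rfl fun l _ => by rw [hA k l]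

lemma CC_swapB (A : Matrix (Fin n) (Fin n) ℝ)
    (t : Fin n → Fin n → Fin n → Fin n → ℝ) :
    CC A (fun i j k l => t k l i j) = CC A t := by
  simp only [CC]
  have : ∀ s : Fin n → Fin n → Fin n → Fin n → ℝ, ∑ i, ∑ j, ∑ k, ∑ l, s i j k l
      = ∑ k, ∑ l, ∑ i, ∑ j, s i j k l := by
    intro s
    have h1 : ∀ i, ∑ j, ∑ k, ∑ l, s i j k l = ∑ k, ∑ j, ∑ l, s i j k l := fun i => Finset.sum_comm
    simp_rw [h1]
    rw [Finset.sum_comm]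
    refine Finset.sum_congr rfl fun k _ => ?_
    have h2 : ∀ i, ∑ j, ∑ l, s i j k l = ∑ l, ∑ j, s i j k l := fun i => Finset.sum_comm
    simp_rw [h2]
    rw [Finset.sum_comm]
  rw [this]
  refine Finset.sum_congr rfl fun i _ => Finset.sum_congr rfl fun j _ =>
    Finset.sum_congr rfl fun k _ => Finset.sum_congr rfl fun l _ => by ring

lemma CC_int {Ω : Set (Euc n)} (A : Matrix (Fin n) (Fin n) ℝ)
    {t : Euc n → Fin n → Fin n → Fin n → Fin n → ℝ}
    (ht : ∀ i j k l, IntegrableOn (fun x => t x i j k l) Ω) :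
    IntegrableOn (fun x => CC A (t x)) Ω ∧
    ∫ x in Ω, CC A (t x) = CC A (fun i j k l => ∫ x in Ω, t x i j k l) := by
  have h4 : ∀ i j k l, Integrable (fun x => A i j * A k l * t x i j k l) (volume.restrict Ω) :=
    fun i j k l => (ht i j k l).const_mul _
  have h3 : ∀ i j k, Integrable (fun x => ∑ l, A i j * A k l * t x i j k l) (volume.restrict Ω) :=
    fun i j k => integrable_finsetSum _ fun l _ => h4 i j k l
  have h2 : ∀ i j, Integrable (fun x => ∑ k, ∑ l, A i j * A k l * t x i j k l)
    (volume.restrict Ω) := fun i j => integrable_finsetSum _ fun k _ => h3 i j k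
  have h1 : ∀ i, Integrable (fun x => ∑ j, ∑ k, ∑ l, A i j * A k l * t x i j k l)
    (volume.restrict Ω) := fun i => integrable_finsetSum _ fun j _ => h2 i j
  refine ⟨integrable_finsetSum _ fun i _ => h1 i, ?_⟩
  simp only [CC]
  rw [integral_finsetSum _ fun i _ => h1 i]
  refine Finset.sum_congr rfl fun i _ => ?_
  rw [integral_finsetSum _ fun j _ => h2 i j]
  refine Finset.sum_congr rfl fun j _ => ?_
  rw [integral_finsetSum _ fun k _ => h3 i j k]
  refine Finset.sum_congr rfl fun k _ => ?_
  rw [integral_finsetSum _ fun l _ => h4 i j k l]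
  refine Finset.sum_congr rfl fun l _ => ?_
  rw [integral_const_mul]

lemma exists_cutoff {Ω K : Set (Euc n)} (hΩ : IsOpen Ω) (hK : IsCompact K) (hKΩ : K ⊆ Ω) :
    ∃ (ζ : Euc n → ℝ) (K' : Set (Euc n)), ContDiff ℝ 1 ζ ∧ IsCompact K' ∧ K' ⊆ Ω ∧
      (∀ x, x ∉ K' → ζ x = 0) ∧ (∀ x ∈ K, ∀ᶠ y in 𝓝 x, ζ y = 1) := by
  obtain ⟨K1, hK1, h1, h2⟩ := exists_compact_between hK hΩ hKΩ
  obtain ⟨K2, hK2, h3, h4⟩ := exists_compact_between hK1 hΩ h2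
  obtain ⟨ζ, h5, -, h6, h7⟩ := exists_contMDiff_support_eq_eq_one_iff (n := 1)
    (modelWithCornersSelf ℝ (Euc n)) isOpen_interior hK1.isClosed h3
  refine ⟨ζ, K2, h5.contDiff, hK2, h4, ?_, ?_⟩
  · intro x hx
    by_contra h
    exact hx (interior_subset (h6 ▸ (Function.mem_support.2 h)))
  · intro x hx
    filter_upwards [isOpen_interior.mem_nhds (h1 hx)] with y hy
    exact (h7 y).1 (interior_subset hy)

section
variable {Ω K : Set (Euc n)} (hΩ : IsOpen Ω) {v φ : Euc n → ℝ} (hv : ContDiffOn ℝ 2 v Ω)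
  (hφ : ContDiff ℝ 2 φ) (hK : IsCompact K) (hKΩ : K ⊆ Ω) (h0 : ∀ x, x ∉ K → φ x = 0)

include hΩ hv hφ hK hKΩ h0

lemma schwarz_idx (i j k l : Fin n) :
    ∫ x in Ω, (φ x * (pder2 v j i x * pder2 v l k x - pder2 v l i x * pder2 v j k x)
      + (pder v i x * pder φ j x * pder2 v l k x - pder v i x * pder φ l x * pder2 v j k x)) = 0 := by
  obtain ⟨ζ, K', hζ, hK', hKΩ', hζ0, hζ1⟩ := exists_cutoff hΩ hK hKΩ
  have hpv : ∀ i, ContDiffOn ℝ 1 (pder v i) Ω := fun i =>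
    contDiffOn_pder (m := 1) (k := 2) hΩ i (by norm_num) (by exact_mod_cast hv)
  set F : Euc n → ℝ := fun x => φ x * pder v i x with hFdef
  set g : Euc n → ℝ := fun x => ζ x * pder v k x with hgdef
  have hF0 : ∀ x, x ∉ K → F x = 0 := fun x hx => by simp [hFdef, h0 x hx]
  have hg0 : ∀ x, x ∉ K' → g x = 0 := fun x hx => by simp [hgdef, hζ0 x hx]
  have hF : ContDiff ℝ 1 F := contDiff_of_support (m := 1) hΩ
    (((hφ.of_le (by norm_num)).contDiffOn).mul (hpv i)) hK hKΩ hF0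
  have hg : ContDiff ℝ 1 g := contDiff_of_support (m := 1) hΩ
    ((hζ.contDiffOn).mul (hpv k)) hK' hKΩ' hg0
  have hs := weak_schwarz hF (hcs hK hF0) hg (hcs hK' hg0) j l
  have z1 : ∀ (j l) x, x ∉ K → pder F j x * pder g l x = 0 := fun j l x hx => by
    rw [pder_zero_off hK hF0 j hx, zero_mul]
  have cF : ∀ j, Continuous (pder F j) := fun j =>
    (hF.continuous_fderiv (by norm_num)).clm_apply continuous_const
  have cg : ∀ j, Continuous (pder g j) := fun j =>
    (hg.continuous_fderiv (by norm_num)).clm_apply continuous_const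
  rw [← setInt_eq hKΩ (z1 j l), ← setInt_eq hKΩ (z1 l j)] at hs
  have hI : ∀ j l, IntegrableOn (fun x => pder F j x * pder g l x) Ω := fun j l =>
    int_of_support hΩ ((cF j).mul (cg l)).continuousOn hK hKΩ (z1 j l)
  have hs2 : ∫ x in Ω, (pder F j x * pder g l x - pder F l x * pder g j x) = 0 := by
    rw [integral_sub (hI j l) (hI l j), hs, sub_self]
  rw [← hs2]
  refine setIntegral_congr_fun hΩ.measurableSet fun x hx => ?_
  have eF : ∀ j, pder F j x = pder φ j x * pder v i x + φ x * pder2 v j i x := fun j =>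
    pder_mul j ((hφ.differentiable (by norm_num)) x) (diffAt_of_contDiffOn hΩ (hpv i) hx)
  by_cases hxK : x ∈ K
  · have eg : ∀ j, pder g j x = pder2 v j k x := by
      intro j
      have : g =ᶠ[𝓝 x] pder v k := by
        filter_upwards [hζ1 x hxK] with y hy
        simp [hgdef, hy]
      simp only [pder2, pder] at *
      rw [this.fderiv_eq]
      rfl
    simp only [eF, eg]
    ring
  · simp only [z1 _ _ x hxK, h0 x hxK, pder_zero_off hK h0 _ hxK]
    ring

lemma ibp_idx (i k j l : Fin n) :
    ∫ x in Ω, (pder v i x * pder φ j x * pder2 v l k x + pder v k x * pder φ j x * pder2 v l i x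
      + pder v i x * pder v k x * pder2 φ l j x) = 0 := by
  have hpv : ∀ i, ContDiffOn ℝ 1 (pder v i) Ω := fun i =>
    contDiffOn_pder (m := 1) (k := 2) hΩ i (by norm_num) (by exact_mod_cast hv)
  have hpφ : ContDiff ℝ 1 (pder φ j) :=
    contDiff_pder (m := 1) (k := 2) j (by norm_num) (by exact_mod_cast hφ)
  have := ibp (F := fun x => (pder v i x * pder φ j x) * pder v k x) hΩ
    (((hpv i).mul hpφ.contDiffOn).mul (hpv k)) hK hKΩ
    (fun x hx => by simp [pder_zero_off hK h0 j hx]) l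
  rw [← this]
  refine setIntegral_congr_fun hΩ.measurableSet fun x hx => ?_
  have d1 := fun i => diffAt_of_contDiffOn hΩ (hpv i) hx
  have d2 := (hpφ.differentiable (by norm_num)) x
  have d3 : DifferentiableAt ℝ (fun x => pder v i x * pder φ j x) x := (d1 i).mul d2
  rw [pder_mul l d3 (d1 k), pder_mul l (d1 i) d2]
  simp only [pder2]
  ring

lemma null_id {A : Matrix (Fin n) (Fin n) ℝ} (hA : ∀ i j, A i j = A j i) :
    ∫ x in Ω, φ x * CC A (fun i j k l => pder2 v i j x * pder2 v k l x
        - pder2 v i l x * pder2 v k j x)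
      = - ∫ x in Ω, CC A (fun i j k l => pder v i x * pder v j x * pder2 φ k l x
        - pder v i x * pder v l x * pder2 φ k j x) := by
  have hpv : ∀ i, ContinuousOn (pder v i) Ω := fun i =>
    (contDiffOn_pder (m := 1) (k := 2) hΩ i (by norm_num) (by exact_mod_cast hv)).continuousOn
  have hpv2 : ∀ i j, ContinuousOn (pder2 v i j) Ω := fun i j =>
    (contDiffOn_pder (m := 0) (k := 1) hΩ i (by norm_num)
      (contDiffOn_pder (m := 1) (k := 2) hΩ j (by norm_num) (by exact_mod_cast hv))).continuousOn
  have hpφ : ∀ i, ContinuousOn (pder φ i) Ω := fun i =>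
    (contDiff_pder (m := 1) (k := 2) i (by norm_num)
      (by exact_mod_cast hφ)).continuous.continuousOn
  have hpφ2 : ∀ i j, ContinuousOn (pder2 φ i j) Ω := fun i j =>
    (contDiff_pder (m := 0) (k := 1) i (by norm_num)
      (contDiff_pder (m := 1) (k := 2) j (by norm_num)
      (by exact_mod_cast hφ))).continuous.continuousOn
  have z1 : ∀ i x, x ∉ K → pder φ i x = 0 := fun i x hx => pder_zero_off hK h0 i hx
  have z2 : ∀ i j x, x ∉ K → pder2 φ i j x = 0 := fun i j x hx => pder_zero_off hK (z1 j) i hx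
  have cφ : ContinuousOn φ Ω := hφ.continuous.continuousOn
  -- integrable blocks
  have ia : ∀ i j k l, IntegrableOn (fun x => φ x * (pder2 v j i x * pder2 v l k x
      - pder2 v l i x * pder2 v j k x)) Ω := fun i j k l =>
    int_of_support hΩ (cφ.mul (((hpv2 j i).mul (hpv2 l k)).sub ((hpv2 l i).mul (hpv2 j k)))) hK hKΩ
      (fun x hx => by simp [h0 x hx])
  have ib : ∀ i j k l, IntegrableOn (fun x => pder v i x * pder φ j x * pder2 v l k x) Ω :=
    fun i j k l => int_of_support hΩ (((hpv i).mul (hpφ j)).mul (hpv2 l k)) hK hKΩ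
      (fun x hx => by simp [z1 _ x hx])
  have ic : ∀ i j k l, IntegrableOn (fun x => pder v i x * pder v j x * pder2 φ k l x) Ω :=
    fun i j k l => int_of_support hΩ (((hpv i).mul (hpv j)).mul (hpφ2 k l)) hK hKΩ
      (fun x hx => by simp [z2 _ _ x hx])
  have ibs : ∀ i j k l, IntegrableOn (fun x => pder v i x * pder φ j x * pder2 v l k x
      - pder v i x * pder φ l x * pder2 v j k x) Ω := fun i j k l => (ib i j k l).sub (ib i l k j)
  have iba : ∀ i j k l, IntegrableOn (fun x => pder v i x * pder φ j x * pder2 v l k x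
      + pder v k x * pder φ j x * pder2 v l i x) Ω := fun i j k l => (ib i j k l).add (ib k j i l)
  have ics : ∀ i j k l, IntegrableOn (fun x => pder v i x * pder v j x * pder2 φ k l x
      - pder v i x * pder v l x * pder2 φ k j x) Ω := fun i j k l => (ic i j k l).sub (ic i l k j)
  -- named integrals
  set B : Fin n → Fin n → Fin n → Fin n → ℝ := fun i j l k =>
    ∫ x in Ω, pder v i x * pder φ j x * pder2 v l k x with hB
  set W : Fin n → Fin n → Fin n → Fin n → ℝ := fun i j k l =>
    ∫ x in Ω, pder v i x * pder v j x * pder2 φ k l x with hW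
  have Bs : ∀ i j l k, B i j l k = B i j k l := by
    intro i j l k
    refine setIntegral_congr_fun hΩ.measurableSet fun x hx => ?_
    rw [pder2_symm hΩ hv hx]
  have e1 : ∀ i j k l, ∫ x in Ω, φ x * (pder2 v j i x * pder2 v l k x
      - pder2 v l i x * pder2 v j k x) = - (B i j l k - B i l j k) := by
    intro i j k l
    have h := schwarz_idx hΩ hv hφ hK hKΩ h0 i j k l
    rw [integral_add (ia i j k l) (ibs i j k l),
      integral_sub (ib i j k l) (ib i l k j)] at h
    simp only [hB]
    linarith
  have e2 : ∀ i k j l, B i j l k + B k j l i + W i k l j = 0 := by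
    intro i k j l
    have h := ibp_idx hΩ hv hφ hK hKΩ h0 i k j l
    rw [integral_add (iba i j k l) (ic i k l j),
      integral_add (ib i j k l) (ib k j i l)] at h
    simp only [hB, hW]
    linarith
  have eL : ∫ x in Ω, φ x * CC A (fun i j k l => pder2 v i j x * pder2 v k l x
        - pder2 v i l x * pder2 v k j x) = CC A (fun i j k l => - (B i j l k - B i l j k)) := by
    rw [← (funext fun i => funext fun j => funext fun k => funext fun l => e1 i j k l),
      ← (CC_int A ia).2]
    refine setIntegral_congr_fun hΩ.measurableSet fun x hx => ?_
    rw [← CC_smul]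
    congr 1
    ext i j k l
    rw [pder2_symm hΩ hv hx i j, pder2_symm hΩ hv hx k l, pder2_symm hΩ hv hx i l,
      pder2_symm hΩ hv hx k j]
  have eR : ∫ x in Ω, CC A (fun i j k l => pder v i x * pder v j x * pder2 φ k l x
        - pder v i x * pder v l x * pder2 φ k j x) = CC A (fun i j k l => W i j k l - W i l k j) := by
    rw [(CC_int A ics).2]
    congr 1
    ext i j k l
    rw [integral_sub (ic i j k l) (ic i l k j)]
  rw [eL, eR, CC_neg, CC_sub, CC_sub]
  -- CC X = CC B i j l k ; S = CC B i l j k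
  have f1 : CC A (fun i j k l => B i j l k) + CC A (fun i j k l => B k j l i)
      + CC A (fun i j k l => W i k l j) = 0 := by
    rw [← CC_add, ← CC_add]
    simp only [e2]
    simp [CC]
  have f2 : CC A (fun i j k l => B i l j k) + CC A (fun i j k l => B j l k i)
      + CC A (fun i j k l => W i j k l) = 0 := by
    rw [← CC_add, ← CC_add]
    have : (fun i j k l => B i l j k + B j l k i + W i j k l) = fun _ _ _ _ => (0:ℝ) := by
      ext i j k l
      rw [Bs i l j k]
      exact e2 i j l k
    rw [this]
    simp [CC]
  have f3 : CC A (fun i j k l => B k j l i) = CC A (fun i j k l => B i l j k) :=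
    CC_swapB A (fun i j k l => B i l j k)
  have f4 : CC A (fun i j k l => B j l k i) = CC A (fun i j k l => B i l j k) := by
    rw [← CC_swap12 hA (fun i j k l => B i l j k)]
    congr 1
    ext i j k l
    rw [Bs j l k i]
  have f5 : CC A (fun i j k l => W i k l j) = CC A (fun i j k l => W i l k j) :=
    CC_swap34 hA (fun i j k l => W i l k j)
  linarith

end

end MT

open MeasureTheory Filter Topology

namespace MT

lemma exists_cut : ∃ (κ : ℝ → ℝ) (C : ℝ), ContDiff ℝ 3 κ ∧ (∀ s ≤ 1, κ s = 0) ∧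
    (∀ s, 2 ≤ s → κ s = s) ∧ (∀ s, 0 ≤ deriv κ s) ∧ (∀ s, 0 ≤ s → 0 ≤ κ s ∧ κ s ≤ s) ∧
    (∀ s, |deriv (deriv κ) s * s| ≤ C) ∧ (∀ s, 2 < s → deriv (deriv κ) s = 0) := by
  set κ : ℝ → ℝ := fun s => s * Real.smoothTransition (s - 1) with hκ
  have c : ContDiff ℝ 3 κ := contDiff_id.mul (Real.smoothTransition.contDiff.comp (by fun_prop))
  have z : ∀ s ≤ 1, κ s = 0 := fun s hs => by
    simp [hκ, Real.smoothTransition.zero_of_nonpos (show s - 1 ≤ 0 by linarith)]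
  have o : ∀ s, 2 ≤ s → κ s = s := fun s hs => by
    simp [hκ, Real.smoothTransition.one_of_one_le (show 1 ≤ s - 1 by linarith)]
  have nn : ∀ s, 0 ≤ s → 0 ≤ κ s := fun s hs => mul_nonneg hs (Real.smoothTransition.nonneg _)
  have mono : Monotone κ := by
    intro a b hab
    by_cases ha : a ≤ 1
    · rw [z a ha]
      by_cases hb : b ≤ 1
      · rw [z b hb]
      · exact nn b (by linarith)
    · push Not at ha
      have := Real.smoothTransition.monotone (show a - 1 ≤ b - 1 by linarith)
      exact mul_le_mul hab this (Real.smoothTransition.nonneg _) (by linarith)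
  have d1 : ContDiff ℝ 2 (deriv κ) := by
    exact (contDiff_succ_iff_deriv.1 (show ContDiff ℝ (2+1) κ by exact_mod_cast c)).2.2
  have d2 : ContDiff ℝ 1 (deriv (deriv κ)) := by
    exact (contDiff_succ_iff_deriv.1 (show ContDiff ℝ (1+1) (deriv κ) by exact_mod_cast d1)).2.2
  have big : ∀ s, 2 < s → deriv (deriv κ) s = 0 := by
    intro s hs
    have h1 : deriv κ =ᶠ[𝓝 s] fun _ => 1 := by
      filter_upwards [isOpen_Ioi.mem_nhds hs] with t ht
      have : κ =ᶠ[𝓝 t] id := by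
        filter_upwards [isOpen_Ioi.mem_nhds ht] with u hu
        exact o u (le_of_lt hu)
      rw [this.deriv_eq]; simp
    rw [h1.deriv_eq]; simp
  have small : ∀ s, s < 1 → deriv (deriv κ) s = 0 := by
    intro s hs
    have h1 : deriv κ =ᶠ[𝓝 s] fun _ => 0 := by
      filter_upwards [isOpen_Iio.mem_nhds hs] with t ht
      have : κ =ᶠ[𝓝 t] fun _ => 0 := by
        filter_upwards [isOpen_Iio.mem_nhds ht] with u hu
        exact z u (le_of_lt hu)
      rw [this.deriv_eq]; simp
    rw [h1.deriv_eq]; simp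
  obtain ⟨C, hC⟩ := (isCompact_Icc (a := (1:ℝ)) (b := 2)).exists_bound_of_continuousOn
    (f := fun s => deriv (deriv κ) s * s) (d2.continuous.mul continuous_id).continuousOn
  have hC0 : 0 ≤ C := (norm_nonneg _).trans (hC 1 (by norm_num))
  refine ⟨κ, C, c, z, o, fun s => mono.deriv_nonneg, fun s hs => ⟨nn s hs, ?_⟩, ?_, big⟩
  · exact mul_le_of_le_one_right hs (Real.smoothTransition.le_one _)
  · intro s
    by_cases h1 : s < 1
    · rw [small s h1]; simpa
    · by_cases h2 : 2 < s
      · rw [big s h2]; simpa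
      · exact hC s ⟨by linarith, by linarith⟩

lemma exists_k : ∃ C : ℝ, ∀ ε : ℝ, 0 < ε → ∃ k : ℝ → ℝ, ContDiff ℝ 3 k ∧ (∀ t ≤ ε, k t = 0) ∧
    (∀ t, 2 * ε ≤ t → k t = t) ∧ (∀ t, 0 ≤ deriv k t) ∧ (∀ t, 0 ≤ t → 0 ≤ k t ∧ k t ≤ t) ∧
    (∀ t, |deriv (deriv k) t * t| ≤ C) ∧ (∀ t, 2 * ε < t → deriv (deriv k) t = 0) := by
  obtain ⟨κ, C, c, z, o, d, b, e, g⟩ := exists_cut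
  refine ⟨C, fun ε hε => ?_⟩
  have hd : ∀ t, deriv (fun t => ε * κ (ε⁻¹ * t)) t = deriv κ (ε⁻¹ * t) := by
    intro t
    rw [deriv_const_mul_field, deriv_comp_mul_left]
    simp; field_simp
  have hd2 : ∀ t, deriv (deriv (fun t => ε * κ (ε⁻¹ * t))) t = ε⁻¹ * deriv (deriv κ) (ε⁻¹ * t) := by
    intro t
    rw [funext hd, deriv_comp_mul_left]
    simp
  refine ⟨fun t => ε * κ (ε⁻¹ * t), ?_, ?_, ?_, ?_, ?_, ?_, ?_⟩
  · exact contDiff_const.mul (c.comp (contDiff_const.mul contDiff_id))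
  · intro t ht
    simp only
    rw [z _ (by rw [inv_mul_le_iff₀ hε]; linarith), mul_zero]
  · intro t ht
    simp only
    rw [o _ (by rw [le_inv_mul_iff₀ hε]; linarith)]
    field_simp
  · intro t; rw [hd]; exact d _
  · intro t ht
    have := b (ε⁻¹ * t) (by positivity)
    refine ⟨mul_nonneg hε.le this.1, ?_⟩
    calc ε * κ (ε⁻¹ * t) ≤ ε * (ε⁻¹ * t) := by gcongr; exact this.2
      _ = t := by field_simp
  · intro t
    rw [hd2]
    have := e (ε⁻¹ * t)
    convert this using 2
    ring
  · intro t ht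
    rw [hd2, g _ (by rw [lt_inv_mul_iff₀ hε]; linarith), mul_zero]

/-- positive part powers -/
lemma hasDerivAt_pos_pow (m : ℕ) (t : ℝ) :
    HasDerivAt (fun t : ℝ => (max t 0) ^ (m + 2)) ((m + 2) * (max t 0) ^ (m + 1)) t := by
  rcases lt_trichotomy t 0 with h | h | h
  · have : (fun t : ℝ => (max t 0) ^ (m + 2)) =ᶠ[𝓝 t] fun _ => 0 := by
      filter_upwards [isOpen_Iio.mem_nhds h] with s hs
      rw [max_eq_right (le_of_lt hs)]; simp
    rw [max_eq_right h.le]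
    simpa using (hasDerivAt_const t (0:ℝ)).congr_of_eventuallyEq this
  · subst h
    simp only [max_self]
    rw [hasDerivAt_iff_isLittleO]
    simp only [sub_zero, max_self, ne_eq, Nat.add_eq_zero_iff, OfNat.ofNat_ne_zero, and_false,
      not_false_eq_true, zero_pow, one_ne_zero, mul_zero, smul_zero]
    have h1 : (fun x : ℝ => (max x 0) ^ (m+2)) =O[𝓝 0] fun x : ℝ => x ^ (m+2) := by
      refine Asymptotics.IsBigO.of_bound 1 (Eventually.of_forall fun x => ?_)
      simp only [norm_pow, one_mul, Real.norm_eq_abs]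
      refine pow_le_pow_left₀ (abs_nonneg _) ?_ _
      rw [abs_of_nonneg (le_max_right x 0)]
      exact max_le (le_abs_self _) (abs_nonneg _)
    have h2 : (fun x : ℝ => x ^ (m+2)) =o[𝓝 0] fun x : ℝ => x := by
      simpa using Asymptotics.isLittleO_pow_pow (𝕜 := ℝ) (m := 1) (n := m+2) (by omega)
    exact h1.trans_isLittleO h2
  · have : (fun t : ℝ => (max t 0) ^ (m + 2)) =ᶠ[𝓝 t] fun s => s ^ (m+2) := by
      filter_upwards [isOpen_Ioi.mem_nhds h] with s hs
      rw [max_eq_left (le_of_lt hs)]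
    rw [max_eq_left h.le]
    have h2 := (hasDerivAt_pow (m+2) t).congr_of_eventuallyEq this
    simpa using h2

lemma contDiff_pos_pow (m : ℕ) : ContDiff ℝ (m + 1 : ℕ) (fun t : ℝ => (max t 0) ^ (m + 2)) := by
  induction m with
  | zero =>
    have : ContDiff ℝ (0 + 1) (fun t : ℝ => (max t 0) ^ (0 + 2)) := by
      rw [contDiff_succ_iff_deriv]
      refine ⟨fun t => (hasDerivAt_pos_pow 0 t).differentiableAt, by simp, ?_⟩
      rw [funext fun t => (hasDerivAt_pos_pow 0 t).deriv]
      rw [contDiff_zero]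
      fun_prop
    simpa using this
  | succ m ih =>
    have : ContDiff ℝ ((m + 1 : ℕ) + 1) (fun t : ℝ => (max t 0) ^ (m + 1 + 2)) := by
      rw [contDiff_succ_iff_deriv]
      refine ⟨fun t => (hasDerivAt_pos_pow (m+1) t).differentiableAt, by simp, ?_⟩
      have e : deriv (fun t : ℝ => (max t 0) ^ (m + 1 + 2)) = fun t : ℝ =>
          (((m + 1 : ℕ) : ℝ) + 2) * (max t 0) ^ (m + 1 + 1) :=
        funext fun t => (hasDerivAt_pos_pow (m+1) t).deriv
      rw [e]
      exact contDiff_const.mul ih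
    exact_mod_cast this

end MT

open MeasureTheory Filter Topology

namespace MT

variable {n : ℕ}

/-- concave `C²` barrier for `Ω` -/
structure Bar (Ω : Set (Euc n)) (f : Euc n → ℝ) : Prop where
  c2 : ContDiff ℝ 2 f
  conc : ConcaveOn ℝ Set.univ f
  pos : ∀ x ∈ Ω, 0 < f x
  npos : ∀ x, x ∉ Ω → f x ≤ 0

lemma vec_sum (a : Euc n) : a = ∑ i, a i • ee i := by
  conv_lhs => rw [← (EuclideanSpace.basisFun (Fin n) ℝ).sum_repr a]
  simp [ee]

lemma fderiv_eq_sum (f : Euc n → ℝ) (x a : Euc n) :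
    fderiv ℝ f x a = ∑ i, pder f i x * a i := by
  conv_lhs => rw [vec_sum a]
  rw [map_sum]
  refine Finset.sum_congr rfl fun i _ => ?_
  rw [map_smul, smul_eq_mul, mul_comm]
  rfl

lemma concave_line {f : Euc n → ℝ} (hf : ConcaveOn ℝ Set.univ f) (x a : Euc n) :
    ConcaveOn ℝ Set.univ (fun t : ℝ => f (x + t • a)) := by
  refine ⟨convex_univ, ?_⟩
  intro s _ t _ p q hp hq hpq
  have h := hf.2 (Set.mem_univ (x + s • a)) (Set.mem_univ (x + t • a)) hp hq hpq
  refine h.trans (le_of_eq ?_)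
  congr 1
  have : x = p • x + q • x := by rw [← add_smul, hpq, one_smul]
  conv_rhs => rw [this]
  simp only [smul_add, add_smul, smul_smul, smul_eq_mul]
  abel

lemma line_deriv {f : Euc n → ℝ} {x a : Euc n} {t : ℝ} (hf : DifferentiableAt ℝ f (x + t • a)) :
    HasDerivAt (fun t : ℝ => f (x + t • a)) (fderiv ℝ f (x + t • a) a) t := by
  have h1 : HasDerivAt (fun t : ℝ => x + t • a) a t := by
    simpa using ((hasDerivAt_id t).smul_const a).const_add x
  exact hf.hasFDerivAt.comp_hasDerivAt t h1

lemma concave_grad {f : Euc n → ℝ} (hf : ConcaveOn ℝ Set.univ f) (hd : Differentiable ℝ f)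
    (x y : Euc n) : f y ≤ f x + ∑ i, pder f i x * (y i - x i) := by
  have h1 := line_deriv (x := x) (a := y - x) (t := 0) (hd _)
  have h2 := (concave_line hf x (y - x)).slope_le_of_hasDerivAt (Set.mem_univ 0) (Set.mem_univ 1)
    zero_lt_one h1
  simp only [slope_def_field, zero_smul, add_zero, one_smul, sub_zero, div_one,
    add_sub_cancel, fderiv_eq_sum] at h2
  simp only [PiLp.sub_apply] at h2
  linarith

lemma concave_hess {f : Euc n → ℝ} (hf : ConcaveOn ℝ Set.univ f) (hd : ContDiff ℝ 2 f)
    (x a : Euc n) : ∑ i, ∑ j, pder2 f i j x * a i * a j ≤ 0 := by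
  have d0 : Differentiable ℝ f := hd.differentiable (by norm_num)
  have hp : ∀ j, Differentiable ℝ (pder f j) := fun j =>
    (contDiff_pder (m := 1) (k := 2) j (by norm_num) (by exact_mod_cast hd)).differentiable
      (by norm_num)
  have h1 := fun t : ℝ => line_deriv (x := x) (a := a) (t := t) (d0 _)
  have h2 := (concave_line hf x a).antitoneOn_deriv fun t _ => (h1 t).differentiableAt
  have e : deriv (fun t : ℝ => f (x + t • a)) = fun t => ∑ j, pder f j (x + t • a) * a j := by
    ext t
    rw [(h1 t).deriv, fderiv_eq_sum]
  rw [e, antitoneOn_univ] at h2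
  have h3 : HasDerivAt (fun t : ℝ => ∑ j, pder f j (x + t • a) * a j)
      (∑ j, (fderiv ℝ (pder f j) (x + (0:ℝ) • a) a) * a j) 0 :=
    HasDerivAt.fun_sum fun j _ => (line_deriv (hp j _)).mul_const _
  have h4 : 0 ≤ deriv (fun t : ℝ => - ∑ j, pder f j (x + t • a) * a j) 0 :=
    Monotone.deriv_nonneg (fun s t hst => neg_le_neg (h2 hst))
  rw [h3.fun_neg.deriv] at h4
  simp only [fderiv_eq_sum, zero_smul, add_zero, Finset.sum_mul] at h4
  rw [Finset.sum_comm] at h4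
  simpa [pder2] using h4

lemma fatou {μ : Measure (Euc n)} {G : ℕ → Euc n → ℝ} {f : Euc n → ℝ} {C : ℝ}
    (hGf : ∀ᵐ x ∂μ, Tendsto (fun m => G m x) atTop (𝓝 (f x)))
    (hG : ∀ m, Integrable (G m) μ) (h0 : ∀ m, ∀ᵐ x ∂μ, 0 ≤ G m x) (hC : ∀ m, ∫ x, G m x ∂μ ≤ C) :
    Integrable f μ := by
  refine ⟨aestronglyMeasurable_of_tendsto_ae _ (fun m => (hG m).1) hGf, ?_⟩
  have hF : ∫⁻ x, ‖f x‖ₑ ∂μ ≤ liminf (fun n ↦ ∫⁻ x, ‖G n x‖ₑ ∂μ) atTop :=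
    lintegral_congr_ae (by filter_upwards [hGf] with x hx using hx.enorm.liminf_eq) ▸
    (MeasureTheory.lintegral_liminf_le' (fun n ↦ (hG n).1.aemeasurable.enorm))
  refine lt_of_le_of_lt hF ?_
  refine lt_of_le_of_lt ?_ (ENNReal.ofReal_lt_top (r := C))
  have : ∀ m, ∫⁻ x, ‖G m x‖ₑ ∂μ ≤ ENNReal.ofReal C := by
    intro m
    have e : ∫⁻ x, ‖G m x‖ₑ ∂μ = ENNReal.ofReal (∫ x, G m x ∂μ) := by
      rw [ofReal_integral_eq_lintegral_ofReal (hG m) (h0 m)]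
      refine lintegral_congr_ae ?_
      filter_upwards [h0 m] with x hx
      exact Real.enorm_of_nonneg hx
    rw [e]
    exact ENNReal.ofReal_le_ofReal (hC m)
  calc _ ≤ liminf (fun _ : ℕ => ENNReal.ofReal C) atTop :=
        liminf_le_liminf (Eventually.of_forall this)
    _ = _ := by simp

end MT

open MeasureTheory Filter Topology

namespace MT

variable {n : ℕ}

/-- truncated square -/
def bet (δ t : ℝ) : ℝ := (max (t - δ) 0) ^ 2 + (max (-t - δ) 0) ^ 2

/-- its derivative -/
def bet1 (δ t : ℝ) : ℝ := 2 * max (t - δ) 0 - 2 * max (-t - δ) 0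

lemma bet_deriv (δ t : ℝ) : HasDerivAt (bet δ) (bet1 δ t) t := by
  have h1 := (hasDerivAt_pos_pow 0 (t - δ)).comp t ((hasDerivAt_id t).sub_const δ)
  have h2 := (hasDerivAt_pos_pow 0 (-t - δ)).comp t (((hasDerivAt_id t).fun_neg).sub_const δ)
  have := h1.fun_add h2
  refine HasDerivAt.congr_deriv (f := bet δ) this ?_
  simp [bet1]
  ring

lemma bet_c1 (δ : ℝ) : ContDiff ℝ 1 (bet δ) := by
  have h := contDiff_pos_pow 0
  exact ((h.comp (contDiff_id.sub contDiff_const)).add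
    (h.comp (contDiff_id.neg.sub contDiff_const)))

lemma bet_nonneg (δ t : ℝ) : 0 ≤ bet δ t := by unfold bet; positivity

lemma bet_zero {δ t : ℝ} (h : |t| < δ) : bet δ t = 0 := by
  rw [abs_lt] at h
  simp [bet, max_eq_right (show t - δ ≤ 0 by linarith), max_eq_right (show -t - δ ≤ 0 by linarith)]

lemma bet1_sq {δ : ℝ} (hδ : 0 < δ) (t : ℝ) : (bet1 δ t) ^ 2 = 4 * bet δ t := by
  unfold bet1 bet
  rcases le_total t 0 with h | h
  · rw [max_eq_right (show t - δ ≤ 0 by linarith)]; ring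
  · rw [max_eq_right (show -t - δ ≤ 0 by linarith)]; ring

lemma bet_tendsto (t : ℝ) {d : ℕ → ℝ} (hd : Tendsto d atTop (𝓝 0)) :
    Tendsto (fun m => bet (d m) t) atTop (𝓝 (t ^ 2)) := by
  have h1 : Tendsto (fun m => bet (d m) t) atTop (𝓝 ((max (t - 0) 0) ^ 2 + (max (-t - 0) 0) ^ 2)) := by
    unfold bet
    exact ((((tendsto_const_nhds.sub hd).max tendsto_const_nhds).pow 2).add
      (((tendsto_const_nhds.sub hd).max tendsto_const_nhds).pow 2))
  convert h1 using 2
  rcases le_total t 0 with h | h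
  · rw [max_eq_right (by linarith), max_eq_left (by linarith)]; ring
  · rw [max_eq_left (by linarith), max_eq_right (by linarith)]; ring

lemma compact_level {Ω : Set (Euc n)} (hb : Bornology.IsBounded Ω)
    {v : Euc n → ℝ} (hv : ContinuousOn v Ω)
    (hz : ∀ x ∈ frontier Ω, Tendsto v (𝓝[Ω] x) (𝓝 0)) {δ : ℝ} (hδ : 0 < δ) (hΩ : IsOpen Ω) :
    IsCompact {x | x ∈ Ω ∧ δ ≤ |v x|} := by
  refine Metric.isCompact_of_isClosed_isBounded ?_ (hb.subset fun x hx => hx.1)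
  rw [← closure_subset_iff_isClosed]
  intro x hx
  have hxΩ : x ∈ closure Ω := closure_mono (fun x hx => hx.1) hx
  by_cases h : x ∈ Ω
  · refine ⟨h, ?_⟩
    by_contra hlt
    push Not at hlt
    have hc : ContinuousAt v x := hv.continuousAt (hΩ.mem_nhds h)
    have : ∀ᶠ y in 𝓝 x, |v y| < δ := hc.abs.eventually_lt continuousAt_const hlt
    obtain ⟨y, hy1, hy2⟩ := (mem_closure_iff_frequently.1 hx).and_eventually this |>.exists
    exact absurd hy1.2 (not_le.2 hy2)
  · exfalso
    have hf : x ∈ frontier Ω := ⟨hxΩ, by rwa [hΩ.interior_eq]⟩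
    have h1 : ∀ᶠ y in 𝓝[Ω] x, |v y| < δ := by
      have := (hz x hf).abs
      rw [abs_zero] at this
      exact this.eventually_lt tendsto_const_nhds hδ
    rw [eventually_nhdsWithin_iff] at h1
    obtain ⟨y, hy1, hy2⟩ := (mem_closure_iff_frequently.1 hx).and_eventually h1 |>.exists
    exact absurd hy1.2 (not_le.2 (hy2 hy1.1))

lemma hardy_step {Ω : Set (Euc n)} (hΩ : IsOpen Ω) (hb : Bornology.IsBounded Ω) {f v : Euc n → ℝ}
    (hf : Bar Ω f) (hn : 1 ≤ n) {x0 : Euc n} (hx0 : x0 ∈ Ω) (hv : ContDiffOn ℝ 1 v Ω)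
    (hz : ∀ x ∈ frontier Ω, Tendsto v (𝓝[Ω] x) (𝓝 0))
    (hg : IntegrableOn (fun x => ∑ i, (pder v i x) ^ 2) Ω)
    (hoff : ∀ x, x ∉ Ω → v x = 0) {R : ℝ} (hR : ∀ x ∈ Ω, ∑ i, (x i - x0 i) ^ 2 ≤ R)
    {δ : ℝ} (hδ : 0 < δ) :
    IntegrableOn (fun x => bet δ (v x) / (f x) ^ 2) Ω ∧
    ∫ x in Ω, bet δ (v x) / (f x) ^ 2 ≤
      (2 / f x0) * ((2 * R / f x0) * ∫ x in Ω, ∑ i, (pder v i x) ^ 2) := by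
  set K := {x | x ∈ Ω ∧ δ ≤ |v x|} with hKdef
  have hK : IsCompact K := compact_level hb hv.continuousOn hz hδ hΩ
  have hKΩ : K ⊆ Ω := fun x hx => hx.1
  have f0 := hf.pos x0 hx0
  have z : ∀ x, x ∉ K → bet δ (v x) = 0 := by
    intro x hx
    apply bet_zero
    by_contra h
    push Not at h
    by_cases hxΩ : x ∈ Ω
    · exact hx ⟨hxΩ, h⟩
    · rw [hoff x hxΩ] at h; simp at h; linarith
  have fc : ContDiffOn ℝ 1 f Ω := (hf.c2.of_le (by norm_num)).contDiffOn
  have fne : ∀ x ∈ Ω, f x ≠ 0 := fun x hx => (hf.pos x hx).ne'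
  have bc : ContDiffOn ℝ 1 (fun x => bet δ (v x)) Ω := (bet_c1 δ).comp_contDiffOn hv
  have ic : ContDiffOn ℝ 1 (fun x => (f x)⁻¹) Ω := fc.inv fne
  have xc : ∀ i, ContDiff ℝ 1 (fun x : Euc n => x i - x0 i) := fun i => by fun_prop
  have Fc : ∀ i, ContDiffOn ℝ 1 (fun x => (bet δ (v x) * (x i - x0 i)) * (f x)⁻¹) Ω := fun i =>
    (bc.mul (xc i).contDiffOn).mul ic
  have F0 : ∀ i x, x ∉ K → (bet δ (v x) * (x i - x0 i)) * (f x)⁻¹ = 0 := fun i x hx => by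
    rw [z x hx]; ring
  have hI : IntegrableOn (fun x => bet δ (v x) / (f x) ^ 2) Ω := by
    refine int_of_support hΩ ?_ hK hKΩ (fun x hx => by rw [z x hx]; simp)
    exact bc.continuousOn.div (fc.continuousOn.pow 2) fun x hx => pow_ne_zero _ (fne x hx)
  refine ⟨hI, ?_⟩
  have hS : ∫ x in Ω, ∑ i, pder (fun x => (bet δ (v x) * (x i - x0 i)) * (f x)⁻¹) i x = 0 := by
    rw [integral_finsetSum]
    · exact Finset.sum_eq_zero fun i _ => ibp hΩ (Fc i) hK hKΩ (F0 i) i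
    · intro i _
      exact int_of_support hΩ (contDiffOn_pder (m := 0) (k := 1) hΩ i (by norm_num) (Fc i)).continuousOn
        hK hKΩ fun x hx => pder_zero_off hK (F0 i) i hx
  have hSI : IntegrableOn
      (fun x => ∑ i, pder (fun x => (bet δ (v x) * (x i - x0 i)) * (f x)⁻¹) i x) Ω := by
    refine integrable_finsetSum _ fun i _ => ?_
    exact int_of_support hΩ (contDiffOn_pder (m := 0) (k := 1) hΩ i (by norm_num) (Fc i)).continuousOn
        hK hKΩ fun x hx => pder_zero_off hK (F0 i) i hx
  have pw : ∀ x ∈ Ω, (f x0 / 2) * (bet δ (v x) / (f x) ^ 2)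
      - (2 * R / f x0) * ∑ i, (pder v i x) ^ 2
      ≤ ∑ i, pder (fun x => (bet δ (v x) * (x i - x0 i)) * (f x)⁻¹) i x := by
    intro x hx
    have fp := hf.pos x hx
    have dv := diffAt_of_contDiffOn hΩ hv hx
    have df : DifferentiableAt ℝ f x := (hf.c2.differentiable (by norm_num)) x
    have db : DifferentiableAt ℝ (fun x => bet δ (v x)) x := diffAt_of_contDiffOn hΩ bc hx
    have eb : ∀ i, pder (fun x => bet δ (v x)) i x = bet1 δ (v x) * pder v i x := fun i => by
      rw [pder_comp i dv (bet_deriv _ _).differentiableAt, (bet_deriv _ _).deriv]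
    have ef : ∀ i, pder (fun x => (f x)⁻¹) i x = - ((f x) ^ 2)⁻¹ * pder f i x := fun i => by
      rw [pder_comp (k := fun y => y⁻¹) i df (differentiableAt_inv fp.ne'), deriv_inv]
    have ex : ∀ i, pder (fun x : Euc n => x i - x0 i) i x = 1 := fun i => by
      have : HasFDerivAt (fun x : Euc n => x i - x0 i) (EuclideanSpace.proj i : Euc n →L[ℝ] ℝ) x :=
        ((EuclideanSpace.proj i : Euc n →L[ℝ] ℝ).hasFDerivAt).sub_const _
      simp [pder, this.fderiv]
    have e : ∀ i, pder (fun x => (bet δ (v x) * (x i - x0 i)) * (f x)⁻¹) i x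
        = bet1 δ (v x) / f x * (pder v i x * (x i - x0 i)) + bet δ (v x) / f x
          + bet δ (v x) / (f x) ^ 2 * (pder f i x * (x0 i - x i)) := by
      intro i
      have dx : DifferentiableAt ℝ (fun x : Euc n => x i - x0 i) x := by fun_prop
      have d2 : DifferentiableAt ℝ (fun x => bet δ (v x) * (x i - x0 i)) x := db.mul dx
      rw [pder_mul i d2 (diffAt_of_contDiffOn hΩ ic hx), pder_mul i db dx, eb, ef, ex]
      field_simp
      ring
    simp only [e, Finset.sum_add_distrib, ← Finset.mul_sum]
    have hgr := concave_grad hf.conc (hf.c2.differentiable (by norm_num)) x x0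
    set T := ∑ i, pder f i x * (x0 i - x i)
    set P := ∑ i, pder v i x * (x i - x0 i) with hP
    set V := ∑ i, (pder v i x) ^ 2
    set b := bet δ (v x) with hbd
    have hb0 : 0 ≤ b := bet_nonneg _ _
    have hP2 : P ^ 2 ≤ V * R := by
      refine (Finset.sum_mul_sq_le_sq_mul_sq _ _ _).trans ?_
      exact mul_le_mul_of_nonneg_left (hR x hx) (Finset.sum_nonneg fun i _ => sq_nonneg _)
    have hsq := bet1_sq hδ (v x)
    rw [← hbd] at hsq
    set a := bet1 δ (v x) / f x with ha
    have ha2 : a ^ 2 = 4 * (b / (f x) ^ 2) := by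
      rw [ha, div_pow, hsq]; ring
    have hn' : (1:ℝ) ≤ n := by exact_mod_cast hn
    have h1 : b / f x ≤ ∑ _i : Fin n, b / f x := by
      simp only [Finset.sum_const, Finset.card_univ, Fintype.card_fin, nsmul_eq_mul]
      exact le_mul_of_one_le_left (by positivity) hn'
    have h2 : b / (f x) ^ 2 * (f x0 - f x) ≤ b / (f x) ^ 2 * T :=
      mul_le_mul_of_nonneg_left (by linarith) (by positivity)
    have h3 : b / (f x) ^ 2 * (f x0 - f x) = b / (f x) ^ 2 * f x0 - b / f x := by
      field_simp
    have h4 : -((f x0 / 8) * a ^ 2 + (2 / f x0) * P ^ 2) ≤ a * P := by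
      have : 0 ≤ (f x0 / 8) * (a + 4 / f x0 * P) ^ 2 := by positivity
      have e : (f x0 / 8) * (a + 4 / f x0 * P) ^ 2
        = (f x0 / 8) * a ^ 2 + (2 / f x0) * P ^ 2 + a * P := by field_simp; ring
      linarith
    have h5 : (2 / f x0) * P ^ 2 ≤ 2 * R / f x0 * V := by
      calc (2 / f x0) * P ^ 2 ≤ (2 / f x0) * (V * R) := by gcongr
        _ = _ := by ring
    rw [ha2] at h4
    linarith
  have hfin := setIntegral_mono_on ((hI.const_mul (f x0 / 2)).sub (hg.const_mul (2 * R / f x0)))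
    hSI hΩ.measurableSet pw
  rw [hS] at hfin
  have e1 := integral_sub (hI.const_mul (f x0 / 2)) (hg.const_mul (2 * R / f x0))
  simp only [Pi.sub_apply] at hfin
  rw [e1, integral_const_mul, integral_const_mul] at hfin
  have : ∫ x in Ω, bet δ (v x) / (f x) ^ 2
    = (2 / f x0) * ((f x0 / 2) * ∫ x in Ω, bet δ (v x) / (f x) ^ 2) := by field_simp
  rw [this]
  refine mul_le_mul_of_nonneg_left ?_ (by positivity)
  linarith

lemma hardy {Ω : Set (Euc n)} (hΩ : IsOpen Ω) (hb : Bornology.IsBounded Ω) {f v : Euc n → ℝ}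
    (hf : Bar Ω f) (hn : 1 ≤ n) {x0 : Euc n} (hx0 : x0 ∈ Ω) (hv : ContDiffOn ℝ 1 v Ω)
    (hz : ∀ x ∈ frontier Ω, Tendsto v (𝓝[Ω] x) (𝓝 0))
    (hg : IntegrableOn (fun x => ∑ i, (pder v i x) ^ 2) Ω) :
    IntegrableOn (fun x => (v x / f x) ^ 2) Ω := by
  set w := Ω.indicator v with hw
  have wv : ∀ x ∈ Ω, w x = v x := fun x hx => Set.indicator_of_mem hx v
  have hpw : ∀ x ∈ Ω, ∀ i, pder w i x = pder v i x := by
    intro x hx i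
    have : w =ᶠ[𝓝 x] v := by
      filter_upwards [hΩ.mem_nhds hx] with y hy using wv y hy
    simp only [pder]
    rw [this.fderiv_eq]
  obtain ⟨R, hR⟩ : ∃ R, ∀ x ∈ Ω, ∑ i, (x i - x0 i) ^ 2 ≤ R := by
    obtain ⟨C, hC⟩ := hb.isCompact_closure.exists_bound_of_continuousOn
      (f := fun x : Euc n => ∑ i, (x i - x0 i) ^ 2) (by fun_prop)
    exact ⟨C, fun x hx => (le_abs_self _).trans (hC x (subset_closure hx))⟩
  have hd : Tendsto (fun m : ℕ => 1 / ((m : ℝ) + 1)) atTop (𝓝 0) :=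
    tendsto_one_div_add_atTop_nhds_zero_nat
  have st := fun m : ℕ => hardy_step hΩ hb hf hn hx0 (v := w) (hv.congr wv)
    (fun x hx => (hz x hx).congr' (by
      filter_upwards [self_mem_nhdsWithin] with y hy using (wv y hy).symm))
    (hg.congr_fun (fun x hx => by simp only [hpw x hx]) hΩ.measurableSet)
    (fun x hx => Set.indicator_of_notMem hx v) hR (δ := 1 / ((m : ℝ) + 1)) (by positivity)
  refine fatou (G := fun m x => bet (1 / ((m : ℝ) + 1)) (w x) / (f x) ^ 2) ?_
    (fun m => (st m).1) (fun m => Eventually.of_forall fun x => div_nonneg (bet_nonneg _ _)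
      (sq_nonneg _)) (fun m => (st m).2)
  refine (ae_restrict_iff' hΩ.measurableSet).2 (Eventually.of_forall fun x hx => ?_)
  rw [div_pow, ← wv x hx]
  exact (bet_tendsto _ hd).div_const _

end MT

open MeasureTheory Filter Topology

namespace MT

variable {n : ℕ}

/-- bilinear form of `A` -/
def BF (A : Matrix (Fin n) (Fin n) ℝ) (p b : Fin n → ℝ) : ℝ := ∑ i, ∑ j, A i j * p i * b j

lemma CC_prod (A : Matrix (Fin n) (Fin n) ℝ) (s t : Fin n → Fin n → ℝ) :
    CC A (fun i j k l => s i j * t k l) = (∑ i, ∑ j, A i j * s i j) * (∑ k, ∑ l, A k l * t k l) := by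
  simp only [CC, Finset.sum_mul]
  refine Finset.sum_congr rfl fun i _ => Finset.sum_congr rfl fun j _ => ?_
  simp only [Finset.mul_sum]
  refine Finset.sum_congr rfl fun k _ => Finset.sum_congr rfl fun l _ => by ring

lemma BF_symm {A : Matrix (Fin n) (Fin n) ℝ} (hA : ∀ i j, A i j = A j i) (p b : Fin n → ℝ) :
    BF A p b = BF A b p := by
  simp only [BF]
  rw [Finset.sum_comm]
  refine Finset.sum_congr rfl fun i _ => Finset.sum_congr rfl fun j _ => by rw [hA]; ring

lemma BF_cs {A : Matrix (Fin n) (Fin n) ℝ} (hA : ∀ i j, A i j = A j i)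
    (hp : ∀ a, 0 ≤ BF A a a) (p b : Fin n → ℝ) : BF A p b * BF A b p ≤ BF A p p * BF A b b := by
  have h : ∀ t : ℝ, 0 ≤ BF A b b * (t * t) + (2 * BF A p b) * t + BF A p p := by
    intro t
    have h1 := hp (fun i => p i + t * b i)
    have h2 : BF A (fun i => p i + t * b i) (fun i => p i + t * b i)
        = BF A p p + t * BF A p b + t * BF A b p + t * t * BF A b b := by
      simp only [BF, Finset.mul_sum, ← Finset.sum_add_distrib]
      refine Finset.sum_congr rfl fun i _ => Finset.sum_congr rfl fun j _ => by ring
    rw [h2, BF_symm hA b p] at h1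
    linarith
  have := discrim_le_zero h
  rw [discrim] at this
  rw [BF_symm hA b p]
  nlinarith

lemma CC_rank1 (A : Matrix (Fin n) (Fin n) ℝ) (p b : Fin n → ℝ) :
    CC A (fun i j k l => p i * p j * (b k * b l) - p i * p l * (b k * b j))
      = BF A p p * BF A b b - BF A p b * BF A b p := by
  rw [CC_sub]
  have e : CC A (fun i j k l => p i * p l * (b k * b j))
    = CC A (fun i j k l => (p i * b j) * (b k * p l)) := by
    congr 1; ext i j k l; ring
  rw [e, CC_prod A (fun i j => p i * p j) (fun k l => b k * b l),
    CC_prod A (fun i j => p i * b j) (fun k l => b k * p l)]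
  simp only [BF, mul_assoc]

lemma CC_sum {r : ℕ} (A : Matrix (Fin n) (Fin n) ℝ) (t : Fin r → Fin n → Fin n → Fin n → Fin n → ℝ) :
    CC A (fun i j k l => ∑ m, t m i j k l) = ∑ m, CC A (t m) := by
  have h : ∀ s : Finset (Fin r), CC A (fun i j k l => ∑ m ∈ s, t m i j k l)
      = ∑ m ∈ s, CC A (t m) := by
    intro s
    induction s using Finset.induction_on with
    | empty => simp [CC]
    | insert a s ha ih =>
      simp only [Finset.sum_insert ha]
      rw [CC_add, ih]
  exact h _

lemma MH_nonpos {A : Matrix (Fin n) (Fin n) ℝ} (hA : ∀ i j, A i j = A j i)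
    (hp : ∀ a, 0 ≤ BF A a a) (p : Fin n → ℝ) {H : Fin n → Fin n → ℝ} (hH : ∀ i j, H i j = H j i)
    (hN : ∀ a : Fin n → ℝ, ∑ i, ∑ j, H i j * a i * a j ≤ 0) :
    CC A (fun i j k l => p i * p j * H k l - p i * p l * H k j) ≤ 0 := by
  have hps : (Matrix.of (fun i j => - H i j)).PosSemidef := by
    refine Matrix.PosSemidef.of_dotProduct_mulVec_nonneg ?_ ?_
    · ext i j
      simp [hH i j]
    · intro a
      have := hN a
      simp only [Matrix.mulVec, dotProduct, Matrix.of_apply, Pi.star_apply, star_trivial,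
        Finset.mul_sum]
      rw [← neg_nonneg, ← Finset.sum_neg_distrib] at this
      simp only [← Finset.sum_neg_distrib] at this
      refine this.trans (le_of_eq ?_)
      refine Finset.sum_congr rfl fun i _ => Finset.sum_congr rfl fun j _ => by ring
  obtain ⟨r, B, hB⟩ := (Matrix.posSemidef_iff_eq_sum_vecMulVec).1 hps
  have e : ∀ k l, H k l = ∑ m, - (B m k * B m l) := by
    intro k l
    have := congrFun (congrFun hB k) l
    simp only [Matrix.of_apply, Matrix.sum_apply, Matrix.vecMulVec_apply, star_trivial] at this
    rw [Finset.sum_neg_distrib, ← this]; ring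
  have e2 : (fun i j k l => p i * p j * H k l - p i * p l * H k j)
      = fun i j k l => ∑ m, - (p i * p j * (B m k * B m l) - p i * p l * (B m k * B m j)) := by
    ext i j k l
    rw [e, e, Finset.mul_sum, Finset.mul_sum, ← Finset.sum_sub_distrib]
    refine Finset.sum_congr rfl fun m _ => by ring
  rw [e2, CC_sum]
  refine Finset.sum_nonpos fun m _ => ?_
  rw [CC_neg, CC_rank1]
  have := BF_cs hA hp p (B m)
  linarith

/-- barrier superlevel sets are compact in `Ω` -/
lemma Bar.compact {Ω : Set (Euc n)} (hb : Bornology.IsBounded Ω) {f : Euc n → ℝ}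
    (hf : Bar Ω f) {ε : ℝ} (hε : 0 < ε) :
    IsCompact {x | ε ≤ f x} ∧ {x | ε ≤ f x} ⊆ Ω := by
  have hs : {x | ε ≤ f x} ⊆ Ω := by
    intro x hx
    by_contra h
    have := hf.npos x h
    have : ε ≤ f x := hx
    linarith
  refine ⟨Metric.isCompact_of_isClosed_isBounded ?_ (hb.subset hs), hs⟩
  exact isClosed_le continuous_const hf.c2.continuous

/-- lower order factor in the tangential integration by parts -/
noncomputable def LL (v f : Euc n → ℝ) (i j k l : Fin n) (x : Euc n) : ℝ :=
  pder f l x * (pder2 v j i x * pder f k x + pder v i x * pder2 f j k x)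
  - pder f j x * (pder2 v l i x * pder f k x + pder v i x * pder2 f l k x)

lemma tang {Ω : Set (Euc n)} (hΩ : IsOpen Ω) (hb : Bornology.IsBounded Ω) {f v : Euc n → ℝ}
    (hf : Bar Ω f) (hv : ContDiffOn ℝ 2 v Ω) {χ : ℝ → ℝ} (hχ : ContDiff ℝ 1 χ) {ε : ℝ}
    (hε : 0 < ε) (hχ0 : ∀ t < ε, χ t = 0) (i j k l : Fin n) :
    IntegrableOn (fun x => χ (f x) * (pder v i x * pder v j x * (pder f k x * pder f l x)
      - pder v i x * pder v l x * (pder f k x * pder f j x))) Ω ∧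
    ∫ x in Ω, χ (f x) * (pder v i x * pder v j x * (pder f k x * pder f l x)
      - pder v i x * pder v l x * (pder f k x * pder f j x))
    = - ∫ x in Ω, χ (f x) * v x * LL v f i j k l x := by
  obtain ⟨hK, hKΩ⟩ := hf.compact hb hε
  set K := {x | ε ≤ f x}
  have z : ∀ x, x ∉ K → χ (f x) = 0 := fun x hx => hχ0 _ (not_le.1 hx)
  have hpv : ∀ i, ContDiffOn ℝ 1 (pder v i) Ω := fun i =>
    contDiffOn_pder (m := 1) (k := 2) hΩ i (by norm_num) (by exact_mod_cast hv)
  have hpv2 : ∀ i j, ContinuousOn (pder2 v i j) Ω := fun i j =>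
    (contDiffOn_pder (m := 0) (k := 1) hΩ i (by norm_num) (hpv j)).continuousOn
  have hpf : ∀ i, ContDiff ℝ 1 (pder f i) := fun i =>
    (contDiff_pder (m := 1) (k := 2) i (by norm_num) (by exact_mod_cast hf.c2))
  have hpf2 : ∀ i j, Continuous (pder2 f i j) := fun i j =>
    (contDiff_pder (m := 0) (k := 1) i (by norm_num) (hpf j)).continuous
  have hv1 : ContDiffOn ℝ 1 v Ω := hv.of_le (by norm_num)
  have hχf : ContDiff ℝ 1 (fun x => χ (f x)) := hχ.comp (hf.c2.of_le (by norm_num))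
  have cL : ContinuousOn (LL v f i j k l) Ω := by
    unfold LL
    have h1 := fun i => (hpv i).continuousOn
    have h2 := fun i => (hpf i).continuous.continuousOn (s := Ω)
    have h3 := fun i j => (hpf2 i j).continuousOn (s := Ω)
    exact ((h2 l).mul (((hpv2 j i).mul (h2 k)).add ((h1 i).mul (h3 j k)))).sub
      ((h2 j).mul (((hpv2 l i).mul (h2 k)).add ((h1 i).mul (h3 l k))))
  have I1 : IntegrableOn (fun x => χ (f x) * (pder v i x * pder v j x * (pder f k x * pder f l x)
      - pder v i x * pder v l x * (pder f k x * pder f j x))) Ω := by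
    have h1 := fun i => (hpv i).continuousOn
    have h2 := fun i => (hpf i).continuous.continuousOn (s := Ω)
    exact int_of_support hΩ (hχf.continuous.continuousOn.mul
      ((((h1 i).mul (h1 j)).mul ((h2 k).mul (h2 l))).sub
        (((h1 i).mul (h1 l)).mul ((h2 k).mul (h2 j))))) hK hKΩ (fun x hx => by rw [z x hx]; ring)
  have I2 : IntegrableOn (fun x => χ (f x) * v x * LL v f i j k l x) Ω :=
    int_of_support hΩ ((hχf.continuous.continuousOn.mul hv1.continuousOn).mul cL)
      hK hKΩ (fun x hx => by rw [z x hx]; ring)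
  refine ⟨I1, ?_⟩
  have Fc : ∀ l, ContDiffOn ℝ 1 (fun x => ((χ (f x) * v x) * (pder v i x * pder f k x))
      * pder f l x) Ω := fun l =>
    ((hχf.contDiffOn.mul hv1).mul ((hpv i).mul (hpf k).contDiffOn)).mul (hpf l).contDiffOn
  have F0 : ∀ l x, x ∉ K → ((χ (f x) * v x) * (pder v i x * pder f k x)) * pder f l x = 0 :=
    fun l x hx => by rw [z x hx]; ring
  have FI : ∀ l j, IntegrableOn (pder (fun x => ((χ (f x) * v x) * (pder v i x * pder f k x))
      * pder f l x) j) Ω := fun l j =>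
    int_of_support hΩ (contDiffOn_pder (m := 0) (k := 1) hΩ j (by norm_num) (Fc l)).continuousOn
        hK hKΩ fun x hx => pder_zero_off hK (F0 l) j hx
  have key : ∫ x in Ω, (pder (fun x => ((χ (f x) * v x) * (pder v i x * pder f k x))
      * pder f l x) j x - pder (fun x => ((χ (f x) * v x) * (pder v i x * pder f k x))
      * pder f j x) l x) = 0 := by
    rw [integral_sub (FI l j) (FI j l), ibp hΩ (Fc l) hK hKΩ (F0 l) j,
      ibp hΩ (Fc j) hK hKΩ (F0 j) l, sub_zero]
  have e : ∀ x ∈ Ω, pder (fun x => ((χ (f x) * v x) * (pder v i x * pder f k x))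
      * pder f l x) j x - pder (fun x => ((χ (f x) * v x) * (pder v i x * pder f k x))
      * pder f j x) l x = χ (f x) * (pder v i x * pder v j x * (pder f k x * pder f l x)
      - pder v i x * pder v l x * (pder f k x * pder f j x)) + χ (f x) * v x * LL v f i j k l x := by
    intro x hx
    have df : DifferentiableAt ℝ f x := (hf.c2.differentiable (by norm_num)) x
    have dχ : DifferentiableAt ℝ χ (f x) := (hχ.differentiable (by norm_num)) _
    have dχf : DifferentiableAt ℝ (fun x => χ (f x)) x := (hχf.differentiable (by norm_num)) _
    have dv := diffAt_of_contDiffOn hΩ hv1 hx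
    have dp := diffAt_of_contDiffOn hΩ (hpv i) hx
    have dq := fun k => ((hpf k).differentiable (by norm_num)) x
    have d1 : DifferentiableAt ℝ (fun x => χ (f x) * v x) x := dχf.mul dv
    have d2 : DifferentiableAt ℝ (fun x => pder v i x * pder f k x) x := dp.mul (dq k)
    have d3 : DifferentiableAt ℝ (fun x => (χ (f x) * v x) * (pder v i x * pder f k x)) x := d1.mul d2
    have ee : ∀ l j, pder (fun x => ((χ (f x) * v x) * (pder v i x * pder f k x))
      * pder f l x) j x = ((deriv χ (f x) * pder f j x * v x + χ (f x) * pder v j x)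
          * (pder v i x * pder f k x) + (χ (f x) * v x) * (pder2 v j i x * pder f k x
            + pder v i x * pder2 f j k x)) * pder f l x
          + ((χ (f x) * v x) * (pder v i x * pder f k x)) * pder2 f j l x := by
      intro l j
      rw [pder_mul j d3 (dq l), pder_mul j d1 d2, pder_mul j dχf dv, pder_mul j dp (dq k),
        pder_comp j df dχ]
      rfl
    rw [ee, ee, pder2_symm isOpen_univ hf.c2.contDiffOn (Set.mem_univ x) j l]
    simp only [LL]
    ring
  rw [setIntegral_congr_fun hΩ.measurableSet e, integral_add I1 I2] at key
  linarith

end MT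

open MeasureTheory Filter Topology

namespace MT

variable {n : ℕ}

lemma memL2 {Ω : Set (Euc n)} (hΩ : IsOpen Ω) {g : Euc n → ℝ} (hg : ContinuousOn g Ω)
    (hi : IntegrableOn (fun x => (g x) ^ 2) Ω) : MemLp g 2 (volume.restrict Ω) :=
  (memLp_two_iff_integrable_sq (hg.aestronglyMeasurable hΩ.measurableSet)).2 hi

lemma memL2_of_le {Ω : Set (Euc n)} (hΩ : IsOpen Ω) {g G : Euc n → ℝ} (hg : ContinuousOn g Ω)
    (hi : IntegrableOn G Ω) (hle : ∀ x, (g x) ^ 2 ≤ G x) : MemLp g 2 (volume.restrict Ω) := by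
  refine memL2 hΩ hg (Integrable.mono' hi ?_ (Eventually.of_forall fun x => ?_))
  · exact (hg.pow 2).aestronglyMeasurable hΩ.measurableSet
  · rw [Real.norm_of_nonneg (sq_nonneg _)]; exact hle x

lemma bmul {Ω : Set (Euc n)} (hb : Bornology.IsBounded Ω) (hΩ : IsOpen Ω) {g h : Euc n → ℝ}
    (hg : IntegrableOn g Ω) (hh : Continuous h) : IntegrableOn (fun x => h x * g x) Ω := by
  obtain ⟨C, hC⟩ := hb.isCompact_closure.exists_bound_of_continuousOn (f := h) hh.continuousOn
  refine Integrable.bdd_mul (c := C) hg hh.aestronglyMeasurable ?_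
  exact (ae_restrict_iff' hΩ.measurableSet).2 (Eventually.of_forall fun x hx =>
    hC x (subset_closure hx))

/-- the null Lagrangian density -/
noncomputable def QQ (A : Matrix (Fin n) (Fin n) ℝ) (v : Euc n → ℝ) (x : Euc n) : ℝ :=
  CC A (fun i j k l => pder2 v i j x * pder2 v k l x - pder2 v i l x * pder2 v k j x)

section
variable {Ω : Set (Euc n)} {v : Euc n → ℝ}

lemma v_cont1 (hΩ : IsOpen Ω) (hv : IsH2H10s Ω v) (i : Fin n) : ContDiffOn ℝ 1 (pder v i) Ω :=
  contDiffOn_pder (m := 1) (k := 2) hΩ i (by norm_num) (by exact_mod_cast hv.contDiffOn)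

lemma v_cont2 (hΩ : IsOpen Ω) (hv : IsH2H10s Ω v) (i j : Fin n) :
    ContinuousOn (pder2 v i j) Ω :=
  (contDiffOn_pder (m := 0) (k := 1) hΩ i (by norm_num) (v_cont1 hΩ hv j)).continuousOn

lemma v_L2_1 (hΩ : IsOpen Ω) (hv : IsH2H10s Ω v) (i : Fin n) :
    MemLp (pder v i) 2 (volume.restrict Ω) := by
  refine memL2_of_le hΩ (v_cont1 hΩ hv i).continuousOn hv.grad_memL2 fun x => ?_
  exact Finset.single_le_sum (f := fun i => (pder v i x) ^ 2) (fun i _ => sq_nonneg _)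
    (Finset.mem_univ i)

lemma v_L2_2 (hΩ : IsOpen Ω) (hv : IsH2H10s Ω v) (i j : Fin n) :
    MemLp (pder2 v i j) 2 (volume.restrict Ω) := by
  refine memL2_of_le hΩ (v_cont2 hΩ hv i j) hv.hess_memL2 fun x => ?_
  refine (Finset.single_le_sum (f := fun j => (pder2 v i j x) ^ 2) (fun j _ => sq_nonneg _)
    (Finset.mem_univ j)).trans ?_
  exact Finset.single_le_sum (f := fun i => ∑ j, (pder2 v i j x) ^ 2)
    (fun i _ => Finset.sum_nonneg fun j _ => sq_nonneg _) (Finset.mem_univ i)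

lemma v_int (hΩ : IsOpen Ω) (hv : IsH2H10s Ω v) (i j k l : Fin n) :
    IntegrableOn (fun x => pder2 v i j x * pder2 v k l x) Ω :=
  (v_L2_2 hΩ hv i j).integrable_mul (v_L2_2 hΩ hv k l)

lemma QQ_int (hΩ : IsOpen Ω) (hv : IsH2H10s Ω v) (A : Matrix (Fin n) (Fin n) ℝ) :
    IntegrableOn (QQ A v) Ω :=
  (CC_int A (t := fun x i j k l => pder2 v i j x * pder2 v k l x - pder2 v i l x * pder2 v k j x)
    fun i j k l => (v_int hΩ hv i j k l).sub (v_int hΩ hv i l k j)).1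

/-- error term vanishes -/
lemma err_tendsto (hΩ : IsOpen Ω) (hb : Bornology.IsBounded Ω) {f : Euc n → ℝ}
    (hf : Bar Ω f) (hn : 1 ≤ n) {x0 : Euc n} (hx0 : x0 ∈ Ω) (hv : IsH2H10s Ω v)
    {C : ℝ} {χ : ℕ → ℝ → ℝ} (hχ : ∀ m, Continuous (χ m)) (hC : ∀ m t, |χ m t * t| ≤ C)
    (hz : ∀ t, 0 < t → ∀ᶠ m in atTop, χ m t = 0) (i j k l : Fin n) :
    Tendsto (fun m => ∫ x in Ω, χ m (f x) * v x * LL v f i j k l x) atTop (𝓝 0) := by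
  have hv1 : ContDiffOn ℝ 1 v Ω := hv.contDiffOn.of_le (by norm_num)
  have fne : ∀ x ∈ Ω, f x ≠ 0 := fun x hx => (hf.pos x hx).ne'
  have hpf : ∀ i, ContDiff ℝ 1 (pder f i) := fun i =>
    (contDiff_pder (m := 1) (k := 2) i (by norm_num) (by exact_mod_cast hf.c2))
  have hpf1 : ∀ i, Continuous (pder f i) := fun i => (hpf i).continuous
  have hpf2 : ∀ i j, Continuous (pder2 f i j) := fun i j =>
    (contDiff_pder (m := 0) (k := 1) i (by norm_num) (hpf j)).continuous
  have hH : MemLp (fun x => v x / f x) 2 (volume.restrict Ω) :=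
    memL2 hΩ (hv1.continuousOn.div hf.c2.continuous.continuousOn fne)
      (hardy hΩ hb hf hn hx0 hv1 hv.zero_trace hv.grad_memL2)
  have i1 : ∀ i, IntegrableOn (fun x => v x / f x * pder v i x) Ω := fun i =>
    hH.integrable_mul (v_L2_1 hΩ hv i)
  have i2 : ∀ i j, IntegrableOn (fun x => v x / f x * pder2 v i j x) Ω := fun i j =>
    hH.integrable_mul (v_L2_2 hΩ hv i j)
  have iL : IntegrableOn (fun x => v x / f x * LL v f i j k l x) Ω := by
    have a1 := bmul hb hΩ (i2 j i) ((hpf1 l).mul (hpf1 k))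
    have a2 := bmul hb hΩ (i1 i) ((hpf1 l).mul (hpf2 j k))
    have a3 := bmul hb hΩ (i2 l i) ((hpf1 j).mul (hpf1 k))
    have a4 := bmul hb hΩ (i1 i) ((hpf1 j).mul (hpf2 l k))
    refine ((a1.add a2).sub (a3.add a4)).congr_fun (fun x _ => ?_) hΩ.measurableSet
    simp only [LL, Pi.add_apply, Pi.sub_apply, Pi.mul_apply]
    ring
  have cL : ContinuousOn (LL v f i j k l) Ω := by
    unfold LL
    have h1 := fun i => (v_cont1 hΩ hv i).continuousOn
    have h2 := fun i => (hpf1 i).continuousOn (s := Ω)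
    have h3 := fun i j => (hpf2 i j).continuousOn (s := Ω)
    have h4 := fun i j => v_cont2 hΩ hv i j
    exact ((h2 l).mul (((h4 j i).mul (h2 k)).add ((h1 i).mul (h3 j k)))).sub
      ((h2 j).mul (((h4 l i).mul (h2 k)).add ((h1 i).mul (h3 l k))))
  have := tendsto_integral_of_dominated_convergence (μ := volume.restrict Ω)
    (F := fun m x => χ m (f x) * v x * LL v f i j k l x) (f := fun _ => (0:ℝ))
    (fun x => C * ‖v x / f x * LL v f i j k l x‖) (fun m => ?_) (iL.norm.const_mul C)
    (fun m => ?_) ?_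
  · simpa using this
  · exact (((((hχ m).comp hf.c2.continuous).continuousOn).mul hv1.continuousOn).mul
      cL).aestronglyMeasurable hΩ.measurableSet
  · refine (ae_restrict_iff' hΩ.measurableSet).2 (Eventually.of_forall fun x hx => ?_)
    have e : χ m (f x) * v x * LL v f i j k l x
      = (χ m (f x) * f x) * (v x / f x * LL v f i j k l x) := by
      have := fne x hx
      field_simp
    rw [e, norm_mul]
    exact mul_le_mul_of_nonneg_right (hC m _) (norm_nonneg _)
  · refine (ae_restrict_iff' hΩ.measurableSet).2 (Eventually.of_forall fun x hx => ?_)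
    refine tendsto_const_nhds.congr' ?_
    filter_upwards [hz (f x) (hf.pos x hx)] with m hm
    rw [hm]; ring

lemma step_ineq (hΩ : IsOpen Ω) (hb : Bornology.IsBounded Ω) {f : Euc n → ℝ}
    (hf : Bar Ω f) (hv : IsH2H10s Ω v) {A : Matrix (Fin n) (Fin n) ℝ}
    (hA : ∀ i j, A i j = A j i) (hp : ∀ a, 0 ≤ BF A a a) {k : ℝ → ℝ} (hk : ContDiff ℝ 3 k)
    {ε : ℝ} (hε : 0 < ε) (hk0 : ∀ t ≤ ε, k t = 0) (hk1 : ∀ t, 0 ≤ deriv k t) :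
    CC A (fun i j r l => ∫ x in Ω, deriv (deriv k) (f x) * v x * LL v f i j r l x)
      ≤ ∫ x in Ω, k (f x) * QQ A v x := by
  obtain ⟨hK, hKΩ⟩ := hf.compact hb hε
  have d1 : ContDiff ℝ 2 (deriv k) := by
    exact (contDiff_succ_iff_deriv.1 (show ContDiff ℝ (2+1) k by exact_mod_cast hk)).2.2
  have d2 : ContDiff ℝ 1 (deriv (deriv k)) := by
    exact (contDiff_succ_iff_deriv.1 (show ContDiff ℝ (1+1) (deriv k) by exact_mod_cast d1)).2.2
  have s1 : ∀ t < ε, deriv k t = 0 := by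
    intro t ht
    have : k =ᶠ[𝓝 t] fun _ => 0 := by
      filter_upwards [isOpen_Iio.mem_nhds ht] with u hu using hk0 u (le_of_lt hu)
    rw [this.deriv_eq]; simp
  have s2 : ∀ t < ε, deriv (deriv k) t = 0 := by
    intro t ht
    have : deriv k =ᶠ[𝓝 t] fun _ => 0 := by
      filter_upwards [isOpen_Iio.mem_nhds ht] with u hu using s1 u hu
    rw [this.deriv_eq]; simp
  have hpf : ∀ i, ContDiff ℝ 1 (pder f i) := fun i =>
    (contDiff_pder (m := 1) (k := 2) i (by norm_num) (by exact_mod_cast hf.c2))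
  have hpf1 : ∀ i, Continuous (pder f i) := fun i => (hpf i).continuous
  have hpf2 : ∀ i j, Continuous (pder2 f i j) := fun i j =>
    (contDiff_pder (m := 0) (k := 1) i (by norm_num) (hpf j)).continuous
  have df : Differentiable ℝ f := hf.c2.differentiable (by norm_num)
  have e1 : ∀ i, (pder (fun x => k (f x)) i) = fun x => deriv k (f x) * pder f i x := fun i => by
    ext x
    exact pder_comp i (df x) ((hk.differentiable (by norm_num)) _)
  have e2 : ∀ i j x, pder2 (fun x => k (f x)) i j x
      = deriv (deriv k) (f x) * (pder f i x * pder f j x) + deriv k (f x) * pder2 f i j x := by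
    intro i j x
    have h1 : DifferentiableAt ℝ (fun x => deriv k (f x)) x :=
      ((d1.differentiable (by norm_num)) _).comp x (df x)
    simp only [pder2]
    rw [show (fun y => pder (fun x => k (f x)) j y) = fun x => deriv k (f x) * pder f j x from e1 j]
    rw [pder_mul i h1 (((hpf j).differentiable (by norm_num)) x),
      pder_comp i (df x) ((d1.differentiable (by norm_num)) _)]
    ring
  have hnull := null_id hΩ hv.contDiffOn (φ := fun x => k (f x))
    ((hk.of_le (by norm_num)).comp hf.c2) hK hKΩ
    (fun x hx => hk0 _ (le_of_lt (not_le.1 hx))) hA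
  have T := fun i j r l => tang hΩ hb hf hv.contDiffOn d2 hε s2 i j r l
  have T1 := (CC_int A (fun i j r l => (T i j r l).1))
  -- integrability of the concavity part
  have I2 : ∀ i j r l, IntegrableOn (fun x => deriv k (f x) * (pder v i x * pder v j x * pder2 f r l x
      - pder v i x * pder v l x * pder2 f r j x)) Ω := by
    intro i j r l
    have h1 := fun i => (v_cont1 hΩ hv i).continuousOn
    have h3 := fun i j => (hpf2 i j).continuousOn (s := Ω)
    refine int_of_support hΩ ((d1.continuous.comp hf.c2.continuous).continuousOn.mul
      ((((h1 i).mul (h1 j)).mul (h3 r l)).sub (((h1 i).mul (h1 l)).mul (h3 r j)))) hK hKΩ ?_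
    intro x hx
    rw [show deriv k (f x) = 0 from s1 _ (not_le.1 hx), zero_mul]
  have T2 := (CC_int A I2)
  have hsplit : ∀ x, CC A (fun i j r l => pder v i x * pder v j x * pder2 (fun x => k (f x)) r l x
        - pder v i x * pder v l x * pder2 (fun x => k (f x)) r j x)
      = CC A (fun i j r l => deriv (deriv k) (f x) *
          (pder v i x * pder v j x * (pder f r x * pder f l x)
            - pder v i x * pder v l x * (pder f r x * pder f j x)))
        + CC A (fun i j r l => deriv k (f x) * (pder v i x * pder v j x * pder2 f r l x
      - pder v i x * pder v l x * pder2 f r j x)) := by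
    intro x
    rw [← CC_add]
    congr 1
    ext i j r l
    rw [e2, e2]
    ring
  simp only [hsplit] at hnull
  rw [integral_add T1.1 T2.1, T1.2] at hnull
  have hneg : ∫ x in Ω, CC A (fun i j r l => deriv k (f x) * (pder v i x * pder v j x * pder2 f r l x
      - pder v i x * pder v l x * pder2 f r j x)) ≤ 0 := by
    refine integral_nonpos fun x => ?_
    rw [CC_smul]
    refine mul_nonpos_of_nonneg_of_nonpos (hk1 _) ?_
    refine MH_nonpos hA hp (fun i => pder v i x) (H := fun i j => pder2 f i j x)
      (fun i j => pder2_symm isOpen_univ hf.c2.contDiffOn (Set.mem_univ x) i j) ?_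
    intro a
    simpa using concave_hess hf.conc hf.c2 x (WithLp.toLp 2 a)
  have hE : CC A (fun i j r l => ∫ x in Ω, deriv (deriv k) (f x) *
          (pder v i x * pder v j x * (pder f r x * pder f l x)
            - pder v i x * pder v l x * (pder f r x * pder f j x)))
      = - CC A (fun i j r l => ∫ x in Ω, deriv (deriv k) (f x) * v x * LL v f i j r l x) := by
    rw [← CC_neg]
    congr 1
    ext i j r l
    exact (T i j r l).2
  rw [hE] at hnull
  have : ∫ x in Ω, k (f x) * QQ A v x = ∫ x in Ω, k (f x) * CC A (fun i j k l =>
    pder2 v i j x * pder2 v k l x - pder2 v i l x * pder2 v k j x) := rfl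
  rw [this, hnull]
  linarith

lemma L1 (hΩ : IsOpen Ω) (hb : Bornology.IsBounded Ω) {f : Euc n → ℝ}
    (hf : Bar Ω f) (hn : 1 ≤ n) {x0 : Euc n} (hx0 : x0 ∈ Ω)
    (hv : IsH2H10s Ω v) {A : Matrix (Fin n) (Fin n) ℝ}
    (hA : ∀ i j, A i j = A j i) (hp : ∀ a, 0 ≤ BF A a a) :
    0 ≤ ∫ x in Ω, f x * QQ A v x := by
  obtain ⟨C, hC⟩ := exists_k
  have hpos : ∀ m : ℕ, (0:ℝ) < 1 / ((m : ℝ) + 1) := fun m => by positivity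
  choose k k3 kz ko kd kb kC kl using fun m : ℕ => hC (1 / ((m : ℝ) + 1)) (hpos m)
  have hd : Tendsto (fun m : ℕ => 2 * (1 / ((m : ℝ) + 1))) atTop (𝓝 0) := by
    simpa using (tendsto_one_div_add_atTop_nhds_zero_nat (𝕜 := ℝ)).const_mul 2
  have d1 : ∀ m, ContDiff ℝ 2 (deriv (k m)) := fun m => by
    exact (contDiff_succ_iff_deriv.1 (show ContDiff ℝ (2+1) (k m) by exact_mod_cast k3 m)).2.2
  have d2 : ∀ m, ContDiff ℝ 1 (deriv (deriv (k m))) := fun m => by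
    exact (contDiff_succ_iff_deriv.1 (show ContDiff ℝ (1+1) (deriv (k m)) by
      exact_mod_cast d1 m)).2.2
  have st := fun m => step_ineq hΩ hb hf hv hA hp (k3 m) (hpos m) (kz m) (kd m)
  have lim1 : Tendsto (fun m => CC A (fun i j r l => ∫ x in Ω, deriv (deriv (k m)) (f x) * v x
      * LL v f i j r l x)) atTop (𝓝 0) := by
    have h := fun i j r l => err_tendsto hΩ hb hf hn hx0 hv (χ := fun m => deriv (deriv (k m)))
      (fun m => (d2 m).continuous) kC (fun t ht => by
        filter_upwards [hd.eventually_lt tendsto_const_nhds ht] with m hm using kl m t hm) i j r l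
    have h2 : Tendsto (fun m => CC A (fun i j r l => ∫ x in Ω, deriv (deriv (k m)) (f x) * v x
      * LL v f i j r l x)) atTop (𝓝 (∑ i, ∑ j, ∑ r, ∑ l, A i j * A r l * 0)) := by
      unfold CC
      refine tendsto_finsetSum _ fun i _ => tendsto_finsetSum _ fun j _ =>
        tendsto_finsetSum _ fun r _ => tendsto_finsetSum _ fun l _ => ?_
      exact (h i j r l).const_mul _
    simpa using h2
  have lim2 : Tendsto (fun m => ∫ x in Ω, k m (f x) * QQ A v x) atTop
      (𝓝 (∫ x in Ω, f x * QQ A v x)) := by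
    have iQ := QQ_int hΩ hv A
    refine tendsto_integral_of_dominated_convergence (fun x => ‖f x * QQ A v x‖) (fun m => ?_)
      (bmul hb hΩ iQ hf.c2.continuous).norm (fun m => ?_) ?_
    · exact (((k3 m).continuous.comp hf.c2.continuous).aestronglyMeasurable).mul iQ.1
    · refine (ae_restrict_iff' hΩ.measurableSet).2 (Eventually.of_forall fun x hx => ?_)
      have hp := hf.pos x hx
      rw [norm_mul, norm_mul]
      refine mul_le_mul_of_nonneg_right ?_ (norm_nonneg _)
      rw [Real.norm_of_nonneg (kb m _ hp.le).1, Real.norm_of_nonneg hp.le]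
      exact (kb m _ hp.le).2
    · refine (ae_restrict_iff' hΩ.measurableSet).2 (Eventually.of_forall fun x hx => ?_)
      refine tendsto_const_nhds.congr' ?_
      filter_upwards [hd.eventually_lt tendsto_const_nhds (hf.pos x hx)] with m hm
      rw [ko m _ hm.le]
  exact le_of_tendsto_of_tendsto' lim1 lim2 st

lemma Bar.expo {f : Euc n → ℝ} (hf : Bar Ω f) {N : ℝ} (hN : 0 < N) :
    Bar Ω (fun x => 1 - Real.exp (-(N * f x))) where
  c2 := contDiff_const.sub (Real.contDiff_exp.comp ((contDiff_const.mul hf.c2).neg))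
  conc := by
    have h1 : ConvexOn ℝ Set.univ (fun x => -(N * f x)) := by
      have := (hf.conc.smul hN.le).neg
      simpa [Pi.neg_def] using this
    have h2 : ConvexOn ℝ Set.univ (fun x => Real.exp (-(N * f x))) := by
      refine ⟨convex_univ, fun x _ y _ a b ha hb hab => ?_⟩
      refine (Real.exp_le_exp.2 (h1.2 (Set.mem_univ x) (Set.mem_univ y) ha hb hab)).trans ?_
      exact convexOn_exp.2 (Set.mem_univ _) (Set.mem_univ _) ha hb hab
    have := h2.neg.add_const 1
    refine this.congr fun x _ => ?_
    change -Real.exp (-(N * f x)) + 1 = 1 - Real.exp (-(N * f x))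
    ring
  pos := by
    intro x hx
    have := hf.pos x hx
    have : Real.exp (-(N * f x)) < 1 := Real.exp_lt_one_iff.2 (by have := mul_pos hN this; linarith)
    linarith
  npos := by
    intro x hx
    have := hf.npos x hx
    have : 1 ≤ Real.exp (-(N * f x)) := Real.one_le_exp (by
      have := mul_nonpos_of_nonneg_of_nonpos hN.le this; linarith)
    linarith

lemma QQ_nonneg (hΩ : IsOpen Ω) (hb : Bornology.IsBounded Ω) {f : Euc n → ℝ}
    (hf : Bar Ω f) (hn : 1 ≤ n) {x0 : Euc n} (hx0 : x0 ∈ Ω)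
    (hv : IsH2H10s Ω v) {A : Matrix (Fin n) (Fin n) ℝ}
    (hA : ∀ i j, A i j = A j i) (hp : ∀ a, 0 ≤ BF A a a) :
    0 ≤ ∫ x in Ω, QQ A v x := by
  have iQ := QQ_int hΩ hv A
  have st := fun m : ℕ => L1 hΩ hb (hf.expo (N := (m : ℝ) + 1) (by positivity)) hn hx0 hv hA hp
  refine ge_of_tendsto' (x := atTop) ?_ st
  refine tendsto_integral_of_dominated_convergence (fun x => ‖QQ A v x‖) (fun m => ?_)
      iQ.norm (fun m => ?_) ?_
  · exact ((hf.expo (N := (m : ℝ) + 1) (by positivity)).c2.continuous.aestronglyMeasurable).mul iQ.1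
  · refine (ae_restrict_iff' hΩ.measurableSet).2 (Eventually.of_forall fun x hx => ?_)
    have hp := (hf.expo (N := (m : ℝ) + 1) (by positivity)).pos x hx
    rw [norm_mul]
    refine mul_le_of_le_one_left (norm_nonneg _) ?_
    rw [Real.norm_of_nonneg hp.le]
    have := Real.exp_pos (-(((m : ℝ) + 1) * f x))
    linarith
  · refine (ae_restrict_iff' hΩ.measurableSet).2 (Eventually.of_forall fun x hx => ?_)
    have hp := hf.pos x hx
    have h1 : Tendsto (fun m : ℕ => Real.exp (-(((m : ℝ) + 1) * f x))) atTop (𝓝 0) := by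
      refine Real.tendsto_exp_neg_atTop_nhds_zero.comp ?_
      exact (tendsto_atTop_add_const_right _ _ tendsto_natCast_atTop_atTop).atTop_mul_const hp
    have h2 := ((tendsto_const_nhds (x := (1:ℝ))).sub h1).mul_const (QQ A v x)
    simpa using h2

end

end MT

open MeasureTheory Filter Topology

namespace MT

variable {n : ℕ}

lemma nondeg {ρ : Euc n → ℝ} {Ω : Set (Euc n)} (hρ : ContDiff ℝ 2 ρ) (hΩ : Ω = {x | ρ x < 0})
    (hc : Convex ℝ Ω) (h0 : Ω ∈ 𝓝 (0 : Euc n)) {y : Euc n} (hy : y ∈ frontier Ω)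
    (hd : fderiv ℝ ρ y ≠ 0) : ρ y = 0 ∧ fderiv ℝ ρ y y ≠ 0 := by
  have hcl : ∀ z ∈ closure Ω, ρ z ≤ 0 := by
    intro z hz
    have : closure Ω ⊆ {z | ρ z ≤ 0} := by
      apply closure_minimal
      · rw [hΩ]; intro z hz; exact le_of_lt (show ρ z < 0 from hz)
      · exact isClosed_le hρ.continuous continuous_const
    exact this hz
  have hy0 : ρ y = 0 := by
    have := frontier_lt_subset_eq hρ.continuous (continuous_const (y := (0 : ℝ)))
    rw [← hΩ] at this
    exact this hy
  refine ⟨hy0, fun hL => hd ?_⟩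
  have hyc : y ∈ closure Ω := frontier_subset_closure hy
  have hmax : IsLocalMaxOn ρ (closure Ω) y := by
    filter_upwards [self_mem_nhdsWithin] with z hz
    rw [hy0]; exact hcl z hz
  have hdr : HasFDerivAt ρ (fderiv ℝ ρ y) y :=
    (hρ.differentiable (by norm_num)).differentiableAt.hasFDerivAt
  have h1 : ∀ z ∈ Ω, fderiv ℝ ρ y z ≤ 0 := by
    intro z hz
    have := hmax.hasFDerivWithinAt_nonpos hdr.hasFDerivWithinAt
      (sub_mem_posTangentConeAt_of_segment_subset
        (hc.closure.segment_subset hyc (subset_closure hz)))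
    rw [map_sub, hL] at this
    linarith
  have h2 : IsLocalMax (fderiv ℝ ρ y) 0 := by
    filter_upwards [h0] with z hz
    simpa using h1 z hz
  have h3 := h2.fderiv_eq_zero
  rwa [ContinuousLinearMap.fderiv] at h3

lemma gauge_c2 {ρ : Euc n → ℝ} {Ω : Set (Euc n)} (hρ : ContDiff ℝ 2 ρ) (hΩ : Ω = {x | ρ x < 0})
    (hc : Convex ℝ Ω) (h0 : Ω ∈ 𝓝 (0 : Euc n)) (hb : Bornology.IsBounded Ω)
    (hd : ∀ y ∈ frontier Ω, fderiv ℝ ρ y ≠ 0) {x : Euc n} (hx : x ≠ 0) :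
    ContDiffAt ℝ 2 (gauge Ω) x := by
  have hpos : ∀ z : Euc n, z ≠ 0 → 0 < gauge Ω z := fun z hz =>
    (gauge_pos (absorbent_nhds_zero h0) (NormedSpace.isVonNBounded_of_isBounded ℝ hb)).2 hz
  have hfr : ∀ z : Euc n, z ≠ 0 → (gauge Ω z)⁻¹ • z ∈ frontier Ω := by
    intro z hz
    rw [← gauge_eq_one_iff_mem_frontier hc h0, gauge_smul_of_nonneg (inv_nonneg.2 (hpos z hz).le),
      smul_eq_mul, inv_mul_cancel₀ (hpos z hz).ne']
  have hzero : ∀ z : Euc n, z ≠ 0 → ρ ((gauge Ω z)⁻¹ • z) = 0 := fun z hz =>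
    (nondeg hρ hΩ hc h0 (hfr z hz) (hd _ (hfr z hz))).1
  set Ψ : Euc n × ℝ → ℝ := fun u => ρ (u.2⁻¹ • u.1) with hΨ
  set u : Euc n × ℝ := (x, gauge Ω x) with hu
  have hgx := hpos x hx
  have hin : ContDiffAt ℝ 2 (fun u : Euc n × ℝ => u.2⁻¹ • u.1) u :=
    (contDiffAt_snd.inv hgx.ne').smul contDiffAt_fst
  have cdf : ContDiffAt ℝ 2 Ψ u := hρ.contDiffAt.comp u hin
  have hgc := continuous_gauge hc h0
  have hpart : fderiv ℝ Ψ u (0, 1) = - (gauge Ω x)⁻¹ *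
      fderiv ℝ ρ ((gauge Ω x)⁻¹ • x) ((gauge Ω x)⁻¹ • x) := by
    have h1 : HasDerivAt (fun s : ℝ => Ψ (x, s)) (fderiv ℝ Ψ u (0, 1)) (gauge Ω x) := by
      have e1 : HasFDerivAt Ψ (fderiv ℝ Ψ u) u :=
        (cdf.differentiableAt (by norm_num)).hasFDerivAt
      have e2 : HasDerivAt (fun s : ℝ => ((x, s) : Euc n × ℝ)) (0, 1) (gauge Ω x) :=
        (hasDerivAt_const _ x).prodMk (hasDerivAt_id _)
      exact HasFDerivAt.comp_hasDerivAt (gauge Ω x) (f := fun s : ℝ => ((x, s) : Euc n × ℝ)) e1 e2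
    have h2 : HasDerivAt (fun s : ℝ => Ψ (x, s))
        (fderiv ℝ ρ ((gauge Ω x)⁻¹ • x) ((-((gauge Ω x)^2)⁻¹) • x)) (gauge Ω x) := by
      have e1 : HasFDerivAt ρ (fderiv ℝ ρ ((gauge Ω x)⁻¹ • x)) ((gauge Ω x)⁻¹ • x) :=
        (hρ.differentiable (by norm_num)).differentiableAt.hasFDerivAt
      have e2 : HasDerivAt (fun s : ℝ => s⁻¹ • x) ((-((gauge Ω x)^2)⁻¹) • x) (gauge Ω x) :=
        (hasDerivAt_inv hgx.ne').smul_const x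
      exact HasFDerivAt.comp_hasDerivAt (gauge Ω x) (f := fun s : ℝ => s⁻¹ • x) e1 e2
    rw [h1.unique h2, map_smul, map_smul, smul_eq_mul, smul_eq_mul]
    field_simp
  have hne : fderiv ℝ Ψ u (0, 1) ≠ 0 := by
    rw [hpart]
    exact mul_ne_zero (neg_ne_zero.2 (inv_ne_zero hgx.ne'))
      (nondeg hρ hΩ hc h0 (hfr x hx) (hd _ (hfr x hx))).2
  have if₂ : (fderiv ℝ Ψ u ∘L .inr ℝ (Euc n) ℝ).IsInvertible := by
    refine ⟨ContinuousLinearEquiv.unitsEquivAut ℝ (Units.mk0 _ hne), ?_⟩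
    ext
    simp
  have pn : (2 : WithTop ℕ∞) ≠ 0 := by norm_num
  have hev := cdf.eventually_apply_eq_iff_implicitFunction pn if₂
  have ht : Tendsto (fun z => (z, gauge Ω z)) (𝓝 x) (𝓝 u) :=
    (continuous_id.prodMk hgc).tendsto x
  have h5 := ht.eventually hev
  have h6 : ∀ᶠ z in 𝓝 x, z ≠ 0 := isOpen_ne.mem_nhds hx
  refine (cdf.contDiffAt_implicitFunction pn if₂).congr_of_eventuallyEq ?_
  filter_upwards [h5, h6] with z h7 h8
  refine (h7.1 ?_).symm
  simp only [hΨ, hu]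
  rw [hzero z h8, hzero x hx]

lemma bar0 {Ω : Set (Euc n)} (ho : IsOpen Ω) (hc : Convex ℝ Ω) (hb : Bornology.IsBounded Ω)
    (h2 : IsC2Domain Ω) (h0 : (0 : Euc n) ∈ Ω) : ∃ f, Bar Ω f := by
  obtain ⟨ρ, hρ, hΩ, hd⟩ := h2
  have hn : Ω ∈ 𝓝 (0 : Euc n) := ho.mem_nhds h0
  have hgc := continuous_gauge hc hn
  have hmem : ∀ x, gauge Ω x < 1 ↔ x ∈ Ω := fun x => by
    rw [gauge_lt_one_iff_mem_interior hc hn, ho.interior_eq]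
  have hgconv : ConvexOn ℝ Set.univ (gauge Ω) := by
    refine ⟨convex_univ, fun x _ y _ a b ha hb' _ => ?_⟩
    refine (gauge_add_le hc (absorbent_nhds_zero hn) _ _).trans ?_
    rw [gauge_smul_of_nonneg ha, gauge_smul_of_nonneg hb']
  refine ⟨fun x => (3/4 : ℝ)^3 - (max (gauge Ω x - 1/4) 0)^3, ?_, ?_, ?_, ?_⟩
  · rw [contDiff_iff_contDiffAt]
    intro x
    refine contDiffAt_const.sub ?_
    by_cases hx : x = 0
    · have : (fun x => (max (gauge Ω x - 1/4) 0)^3) =ᶠ[𝓝 x] fun _ => (0:ℝ) := by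
        have h : ∀ᶠ z in 𝓝 x, gauge Ω z < 1/4 := by
          apply hgc.continuousAt.eventually_lt continuousAt_const
          rw [hx, gauge_zero]; norm_num
        filter_upwards [h] with z hz
        rw [max_eq_right (by linarith)]; norm_num
      exact contDiffAt_const.congr_of_eventuallyEq this
    · have hg := gauge_c2 hρ hΩ hc hn hb hd hx
      have hp := contDiff_pos_pow 1
      exact (ContDiff.contDiffAt (n := 2) (by exact_mod_cast hp)).comp x (hg.sub contDiffAt_const)
  · have h3 : ConvexOn ℝ Set.univ (fun x => max (gauge Ω x - 1/4) 0) :=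
      ConvexOn.sup (hgconv.sub (concaveOn_const _ convex_univ)) (convexOn_const _ convex_univ)
    have h4 : ConvexOn ℝ Set.univ (fun x => (max (gauge Ω x - 1/4) 0)^3) :=
      h3.pow (fun x _ => le_max_right _ _) 3
    exact (concaveOn_const _ convex_univ).sub h4
  · intro x hx
    have := (hmem x).2 hx
    have h3 : max (gauge Ω x - 1/4) 0 < 3/4 := max_lt (by linarith) (by norm_num)
    have := pow_lt_pow_left₀ h3 (le_max_right _ _) (n := 3) (by norm_num)
    linarith
  · intro x hx
    have : 1 ≤ gauge Ω x := not_lt.1 fun h => hx ((hmem x).1 h)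
    have h3 : 3/4 ≤ max (gauge Ω x - 1/4) 0 := le_max_of_le_left (by linarith)
    have := pow_le_pow_left₀ (by norm_num) h3 3
    linarith

lemma exists_bar {Ω : Set (Euc n)} (ho : IsOpen Ω) (hc : Convex ℝ Ω) (hb : Bornology.IsBounded Ω)
    (h2 : IsC2Domain Ω) {x0 : Euc n} (h0 : x0 ∈ Ω) : ∃ f, Bar Ω f := by
  obtain ⟨f, hf⟩ : ∃ f, Bar ((fun x => x + x0) ⁻¹' Ω) f := by
    apply bar0
    · exact ho.preimage (by fun_prop)
    · exact hc.translate_preimage_left x0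
    · have : (fun x => x + x0) ⁻¹' Ω = (fun x => x + (-x0)) '' Ω := by
        ext x; simp
      rw [this]
      exact (LipschitzWith.id.add (LipschitzWith.const (-x0))).isBounded_image hb
    · obtain ⟨ρ, hρ, hΩ, hd⟩ := h2
      refine ⟨fun x => ρ (x + x0), hρ.comp (contDiff_id.add contDiff_const), ?_, ?_⟩
      · rw [hΩ]; rfl
      · intro x hx
        rw [fderiv_comp_add_right]
        apply hd
        have := (Homeomorph.addRight x0).preimage_frontier Ω
        have h3 : x ∈ (Homeomorph.addRight x0) ⁻¹' frontier Ω := by rw [this]; exact hx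
        exact h3
    · simpa using h0
  refine ⟨fun x => f (x + (-x0)), hf.c2.comp (contDiff_id.add contDiff_const), ?_, ?_, ?_⟩
  · have := hf.conc.translate_left (-x0)
    simpa [Function.comp_def] using this
  · intro x hx
    exact hf.pos _ (by simpa using hx)
  · intro x hx
    exact hf.npos _ (by simpa using hx)

end MT

open MeasureTheory Filter Topology

namespace MT

variable {n : ℕ}

def TT (A B X : Matrix (Fin n) (Fin n) ℝ) : ℝ :=
  ∑ i, ∑ j, ∑ k, ∑ l, A i j * B k l * (X i l * X k j)

lemma TT_nonneg {A B X : Matrix (Fin n) (Fin n) ℝ} (hp : ∀ a, 0 ≤ BF A a a)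
    (hB : ∀ i j, B i j = B j i) (hq : ∀ a, 0 ≤ BF B a a) (hX : ∀ i j, X i j = X j i) :
    0 ≤ TT A B X := by
  have hps : B.PosSemidef := by
    refine Matrix.PosSemidef.of_dotProduct_mulVec_nonneg ?_ ?_
    · ext i j; simp [hB i j]
    · intro a
      refine (hq a).trans_eq ?_
      simp only [BF, dotProduct, Matrix.mulVec, Finset.mul_sum]
      refine Finset.sum_congr rfl fun i _ => Finset.sum_congr rfl fun j _ => ?_
      simp; ring
  obtain ⟨r, q, hBq⟩ := (Matrix.posSemidef_iff_eq_sum_vecMulVec).1 hps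
  have hB2 : ∀ k l, B k l = ∑ m, q m k * q m l := by
    intro k l
    rw [hBq]
    simp [Matrix.sum_apply, Matrix.vecMulVec_apply]
  have : TT A B X = ∑ m, BF A (fun i => ∑ l, X i l * q m l) (fun i => ∑ l, X i l * q m l) := by
    simp only [TT, BF]
    simp_rw [hB2]
    have e : ∀ i j, ∑ m, A i j * (∑ l, X i l * q m l) * (∑ l, X j l * q m l)
        = ∑ k, ∑ l, A i j * (∑ m, q m k * q m l) * (X i l * X k j) := by
      intro i j
      simp only [Finset.mul_sum, Finset.sum_mul]
      rw [Finset.sum_comm]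
      refine Finset.sum_congr rfl fun k _ => ?_
      rw [Finset.sum_comm]
      refine Finset.sum_congr rfl fun l _ => ?_
      refine Finset.sum_congr rfl fun m _ => ?_
      rw [hX k j]; ring
    conv_rhs => rw [Finset.sum_comm]
    refine Finset.sum_congr rfl fun i _ => ?_
    conv_rhs => rw [Finset.sum_comm]
    refine Finset.sum_congr rfl fun j _ => ?_
    exact (e i j).symm
  rw [this]
  exact Finset.sum_nonneg fun m _ => hp _

lemma BF_smul (A : Matrix (Fin n) (Fin n) ℝ) (c : ℝ) (a : Fin n → ℝ) :
    BF A (fun i => c * a i) (fun i => c * a i) = c ^ 2 * BF A a a := by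
  simp only [BF, Finset.mul_sum]
  refine Finset.sum_congr rfl fun i _ => Finset.sum_congr rfl fun j _ => by ring

lemma vsq_smul (c : ℝ) (a : Fin n → ℝ) : vsq (fun i => c * a i) = c ^ 2 * vsq a := by
  simp only [vsq, Finset.mul_sum]
  refine Finset.sum_congr rfl fun i _ => by ring

lemma BF_pos {A : Matrix (Fin n) (Fin n) ℝ} (h : A.PosDef) {a : Fin n → ℝ} (ha : a ≠ 0) :
    0 < BF A a a := by
  refine (h.dotProduct_mulVec_pos ha).trans_eq ?_
  simp only [BF, dotProduct, Matrix.mulVec, Finset.mul_sum]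
  refine Finset.sum_congr rfl fun i _ => Finset.sum_congr rfl fun j _ => ?_
  simp; ring

lemma BF_nonneg {A : Matrix (Fin n) (Fin n) ℝ} (h : A.PosDef) (a : Fin n → ℝ) :
    0 ≤ BF A a a := by
  by_cases ha : a = 0
  · subst ha; simp [BF]
  · exact (BF_pos h ha).le

lemma lam1_le {A : Matrix (Fin n) (Fin n) ℝ} (h : A.PosDef) (a : Fin n → ℝ) :
    lam1 A * vsq a ≤ BF A a a := by
  have hu : ∀ b : Fin n → ℝ, vsq b = 1 → lam1 A ≤ BF A b b := by
    intro b hb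
    refine csInf_le ⟨0, ?_⟩ ⟨b, hb, rfl⟩
    rintro _ ⟨c, _, rfl⟩
    exact BF_nonneg h c
  have h0 : 0 ≤ vsq a := Finset.sum_nonneg fun i _ => sq_nonneg _
  rcases h0.eq_or_lt with h1 | h1
  · rw [← h1, mul_zero]; exact BF_nonneg h a
  · have hs : (Real.sqrt (vsq a))⁻¹ ^ 2 = (vsq a)⁻¹ := by
      rw [inv_pow, Real.sq_sqrt h0]
    have := hu (fun i => (Real.sqrt (vsq a))⁻¹ * a i)
      (by rw [vsq_smul, hs, inv_mul_cancel₀ h1.ne'])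
    rw [BF_smul, hs, inv_mul_eq_div, le_div_iff₀ h1] at this
    exact this

lemma lam1_pos {A : Matrix (Fin n) (Fin n) ℝ} (h : A.PosDef) (hn : 1 ≤ n) : 0 < lam1 A := by
  have hcl : IsClosed {a : Fin n → ℝ | vsq a = 1} :=
    isClosed_eq (by unfold vsq; fun_prop) continuous_const
  have hco : IsCompact {a : Fin n → ℝ | vsq a = 1} := by
    refine (isCompact_Icc (a := fun _ : Fin n => (-1 : ℝ)) (b := fun _ => 1)).of_isClosed_subset
      hcl ?_
    intro a ha
    have ha' : vsq a = 1 := ha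
    have : ∀ i, |a i| ≤ 1 := by
      intro i
      have h1 : (a i)^2 ≤ vsq a :=
        Finset.single_le_sum (f := fun i => (a i)^2) (fun i _ => sq_nonneg _) (Finset.mem_univ i)
      rw [ha'] at h1
      exact (sq_le_one_iff_abs_le_one _).1 h1
    exact ⟨fun i => (abs_le.1 (this i)).1, fun i => (abs_le.1 (this i)).2⟩
  have hne : {a : Fin n → ℝ | vsq a = 1}.Nonempty := by
    refine ⟨Pi.single ⟨0, hn⟩ 1, ?_⟩
    change vsq _ = 1
    rw [vsq, Finset.sum_eq_single ⟨0, hn⟩]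
    · simp
    · intro b _ hb; simp [hb]
    · simp
  obtain ⟨a, ha, hmin⟩ := hco.exists_isMinOn hne (f := fun a => BF A a a)
    (by unfold BF; fun_prop)
  have ha' : vsq a = 1 := ha
  have hane : a ≠ 0 := by
    rintro rfl
    simp [vsq] at ha'
  refine (BF_pos h hane).trans_le ?_
  refine le_csInf ⟨_, a, ha', rfl⟩ ?_
  rintro _ ⟨b, hb, rfl⟩
  exact hmin (show b ∈ {a : Fin n → ℝ | vsq a = 1} from hb)

lemma TT_ge {A X : Matrix (Fin n) (Fin n) ℝ} {ν : ℝ} (hA : ∀ i j, A i j = A j i)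
    (hp : ∀ a, 0 ≤ BF A a a) (hν : 0 ≤ ν) (hl : ∀ a, ν * vsq a ≤ BF A a a)
    (hX : ∀ i j, X i j = X j i) : ν ^ 2 * ∑ i, ∑ j, (X i j) ^ 2 ≤ TT A A X := by
  have hI : ∀ a : Fin n → ℝ, BF 1 a a = vsq a := by
    intro a; simp [BF, vsq, Matrix.one_apply, sq]
  set B : Matrix (Fin n) (Fin n) ℝ := A - ν • 1 with hB
  have hBs : ∀ i j, B i j = B j i := by
    intro i j
    simp [hB, hA i j, Matrix.one_apply, eq_comm]
  have hBp : ∀ a, 0 ≤ BF B a a := by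
    intro a
    have : BF B a a = BF A a a - ν * BF 1 a a := by
      simp only [BF, hB, Finset.mul_sum, ← Finset.sum_sub_distrib, Matrix.sub_apply,
        Matrix.smul_apply, smul_eq_mul]
      refine Finset.sum_congr rfl fun i _ => Finset.sum_congr rfl fun j _ => by ring
    rw [this, hI]; linarith [hl a]
  have e1 : TT A A X = TT A B X + ν * TT B 1 X + ν ^ 2 * TT 1 1 X := by
    simp only [TT, hB, Finset.mul_sum, ← Finset.sum_add_distrib, Matrix.sub_apply,
        Matrix.smul_apply, smul_eq_mul]
    refine Finset.sum_congr rfl fun i _ => Finset.sum_congr rfl fun j _ =>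
      Finset.sum_congr rfl fun k _ => Finset.sum_congr rfl fun l _ => by ring
  have e2 : TT 1 1 X = ∑ i, ∑ j, (X i j) ^ 2 := by
    simp only [TT, Matrix.one_apply]
    simp [sq]
    refine Finset.sum_congr rfl fun i _ => Finset.sum_congr rfl fun j _ => by rw [hX j i]
  have h1 := TT_nonneg hp hBs hBp hX
  have h2 := TT_nonneg (B := 1) hBp (fun i j => by simp [Matrix.one_apply, eq_comm])
    (fun a => by rw [hI]; exact Finset.sum_nonneg fun i _ => sq_nonneg _) hX
  rw [e1, e2]
  nlinarith [mul_nonneg hν h2]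

lemma main_ineq {A : Matrix (Fin n) (Fin n) ℝ} (hsym : A.IsSymm) (hpos : A.PosDef)
    {Ω : Set (Euc n)} (ho : IsOpen Ω) (hc : Convex ℝ Ω) (hb : Bornology.IsBounded Ω)
    (h2 : IsC2Domain Ω) {v : Euc n → ℝ} (hv : IsH2H10s Ω v) (hn : 1 ≤ n) :
    lam1 A ^ 2 * (∫ x in Ω, ∑ i, ∑ j, (pder2 v i j x) ^ 2) ≤
      ∫ x in Ω, (∑ i, ∑ j, A i j * pder2 v i j x) ^ 2 := by
  rcases Ω.eq_empty_or_nonempty with rfl | ⟨x0, hx0⟩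
  · simp
  obtain ⟨f, hf⟩ := exists_bar ho hc hb h2 hx0
  have hA : ∀ i j, A i j = A j i := fun i j => hsym.apply j i
  have hq := QQ_nonneg ho hb hf hn hx0 hv hA (BF_nonneg hpos)
  have hsq : ∀ x, CC A (fun i j k l => pder2 v i j x * pder2 v k l x)
      = (∑ i, ∑ j, A i j * pder2 v i j x) ^ 2 := by
    intro x
    rw [CC_prod A (fun i j => pder2 v i j x) (fun i j => pder2 v i j x), sq]
  have hint : IntegrableOn (fun x => (∑ i, ∑ j, A i j * pder2 v i j x) ^ 2) Ω := by
    have := (CC_int A (t := fun x i j k l => pder2 v i j x * pder2 v k l x)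
      fun i j k l => v_int ho hv i j k l).1
    simpa only [hsq] using this
  have hpt : ∀ x ∈ Ω, QQ A v x + lam1 A ^ 2 * (∑ i, ∑ j, (pder2 v i j x) ^ 2)
      ≤ (∑ i, ∑ j, A i j * pder2 v i j x) ^ 2 := by
    intro x hx
    have h3 := TT_ge (X := Matrix.of fun i j => pder2 v i j x) hA (BF_nonneg hpos)
      (lam1_pos hpos hn).le (lam1_le hpos) (fun i j => pder2_symm ho hv.contDiffOn hx i j)
    have h4 : QQ A v x = (∑ i, ∑ j, A i j * pder2 v i j x) ^ 2
        - TT A A (Matrix.of fun i j => pder2 v i j x) := by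
      rw [← hsq x, QQ, CC_sub]
      rfl
    simp only [Matrix.of_apply] at h3
    linarith
  have hqi := QQ_int ho hv A
  have hmono := setIntegral_mono_on (hqi.add (hv.hess_memL2.const_mul (lam1 A ^ 2))) hint
    ho.measurableSet hpt
  have hadd := integral_add hqi (hv.hess_memL2.const_mul (lam1 A ^ 2))
  have hmul := integral_const_mul (μ := volume.restrict Ω) (lam1 A ^ 2)
    (fun x => ∑ i, ∑ j, (pder2 v i j x) ^ 2)
  have hmono' : (∫ x in Ω, (QQ A v x + lam1 A ^ 2 * (∑ i, ∑ j, (pder2 v i j x) ^ 2)))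
    ≤ ∫ x in Ω, (∑ i, ∑ j, A i j * pder2 v i j x) ^ 2 := hmono
  linarith

end MT

/-- The scalar (N = 1) Miranda–Talenti inequality: for any symmetric
positive definite `A ∈ ℝ^{n×n}` with smallest eigenvalue `ν(A) = min_{|a|=1} A:a⊗a`,
any open bounded convex `C²` domain `Ω`, and any `v ∈ (H² ∩ H¹₀)(Ω)`:
`ν(A)² ∫_Ω |D²v|² ≤ ∫_Ω |A:D²v|²`, i.e. `‖D²v‖_{L²} ≤ (1/ν(A)) ‖A:D²v‖_{L²}`. -/
theorem scalar_miranda_talenti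
    {n : ℕ}
    (A : Matrix (Fin n) (Fin n) ℝ) (hsym : A.IsSymm) (hpos : A.PosDef)
    (Ω : Set (Euc n)) (hopen : IsOpen Ω) (hconv : Convex ℝ Ω)
    (hbdd : Bornology.IsBounded Ω) (hC2 : IsC2Domain Ω)
    (v : Euc n → ℝ) (hv : IsH2H10s Ω v) :
    lam1 A ^ 2 * (∫ x in Ω, ∑ i, ∑ j, (pder2 v i j x) ^ 2) ≤
      ∫ x in Ω, (∑ i, ∑ j, A i j * pder2 v i j x) ^ 2 ∧
    Real.sqrt (∫ x in Ω, ∑ i, ∑ j, (pder2 v i j x) ^ 2) ≤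
      (1 / lam1 A) * Real.sqrt (∫ x in Ω, (∑ i, ∑ j, A i j * pder2 v i j x) ^ 2) := by
  rcases Nat.eq_zero_or_pos n with h0 | hn
  · subst h0
    simp
  have h := MT.main_ineq hsym hpos hopen hconv hbdd hC2 hv hn
  refine ⟨h, ?_⟩
  have hl := MT.lam1_pos hpos hn
  have h1 := Real.sqrt_le_sqrt h
  rw [Real.sqrt_mul (sq_nonneg _), Real.sqrt_sq hl.le] at h1
  rw [one_div, inv_mul_eq_div, le_div_iff₀ hl]
  linarith
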